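/- arXiv:1702.02648 — 2 statements merged into one kernel-verified Lean document; each statement's English description precedes it below -/
import Mathlib

section
/- For every graph H with at least one edge which is not vertex-1-balanced, n^{-1/m_1(H)} is a threshold for the property that G(n,p) contains an H-factor: if p·n^{1/m_1(H)} → 0 then a.a.s. G(n,p) contains no H-factor, while if p·n^{1/m_1(H)} → ∞ then a.a.s. G(n,p) contains an H-factor. -/
open MeasureTheory Filter Topology

/-- Bernoulli measure on `Bool` with success probability `p` (clamped to `[0,1]`). -/
noncomputable def bernoulliMeasure (p : ℝ) : Measure Bool :=
  (min (ENNReal.ofReal p) 1) • Measure.dirac true +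
    (1 - min (ENNReal.ofReal p) 1) • Measure.dirac false

/-- The distribution of the binomial random graph `G(n,p)`, as a product of independent
Bernoulli measures, one for each potential edge. -/
noncomputable def gnp (n : ℕ) (p : ℝ) : Measure (Sym2 (Fin n) → Bool) :=
  Measure.pi fun _ => bernoulliMeasure p

/-- The simple graph on `[n]` determined by an outcome of the edge indicators. -/
def graphOf {n : ℕ} (ω : Sym2 (Fin n) → Bool) : SimpleGraph (Fin n) :=
  SimpleGraph.fromRel fun u v => ω s(u, v) = true

/-- `G` contains a (not necessarily induced) copy of `H`. -/
def ContainsCopy {α β : Type*} (H : SimpleGraph α) (G : SimpleGraph β) : Prop :=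
  ∃ f : α → β, Function.Injective f ∧ ∀ ⦃u v⦄, H.Adj u v → G.Adj (f u) (f v)

/-- The maximum degree of a graph on a finite vertex type. -/
noncomputable def maxDeg {V : Type*} [Fintype V] (G : SimpleGraph V) : ℕ :=
  Finset.univ.sup fun v => (G.neighborSet v).ncard

/-- The maximum 0-density `m₀(H)`. -/
noncomputable def m0 {V : Type*} [Fintype V] (H : SimpleGraph V) : ℝ :=
  sSup {x : ℝ | ∃ H' : H.Subgraph, H'.verts.Nonempty ∧
    x = (H'.edgeSet.ncard : ℝ) / (H'.verts.ncard : ℝ)}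

/-- The maximum 1-density `m₁(H)`. -/
noncomputable def m1 {V : Type*} [Fintype V] (H : SimpleGraph V) : ℝ :=
  sSup {x : ℝ | ∃ H' : H.Subgraph, 1 < H'.verts.ncard ∧
    x = (H'.edgeSet.ncard : ℝ) / ((H'.verts.ncard : ℝ) - 1)}

/-- The maximum 2-density `m₂(H)`. -/
noncomputable def m2 {V : Type*} [Fintype V] (H : SimpleGraph V) : ℝ :=
  sSup {x : ℝ | ∃ H' : H.Subgraph, 0 < H'.edgeSet.ncard ∧
    x = if 2 < H'.verts.ncard
      then ((H'.edgeSet.ncard : ℝ) - 1) / ((H'.verts.ncard : ℝ) - 2)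
      else 1 / 2}

/-- The maximum Riordan-density `m_R(H)`. -/
noncomputable def mR {V : Type*} [Fintype V] (H : SimpleGraph V) : ℝ :=
  sSup {x : ℝ | ∃ H' : H.Subgraph, 2 < H'.verts.ncard ∧
    x = (H'.edgeSet.ncard : ℝ) / ((H'.verts.ncard : ℝ) - 2)}

/-- The local 1-density `m₁(x,H)` of `H` at the vertex `x`. -/
noncomputable def m1At {V : Type*} [Fintype V] (H : SimpleGraph V) (x : V) : ℝ :=
  sSup {r : ℝ | ∃ H' : H.Subgraph, x ∈ H'.verts ∧ 1 < H'.verts.ncard ∧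
    r = (H'.edgeSet.ncard : ℝ) / ((H'.verts.ncard : ℝ) - 1)}

/-- `H` is strictly 1-balanced: `H` itself is the unique maximiser of the 1-density. -/
def StrictlyOneBalanced {V : Type*} [Fintype V] (H : SimpleGraph V) : Prop :=
  ∀ H' : H.Subgraph, 1 < H'.verts.ncard → H' ≠ ⊤ →
    (H'.edgeSet.ncard : ℝ) / ((H'.verts.ncard : ℝ) - 1) <
      (H.edgeSet.ncard : ℝ) / ((Fintype.card V : ℝ) - 1)

/-- `H` is vertex-1-balanced: the local 1-density at every vertex equals `m₁(H)`. -/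
def VertexOneBalanced {V : Type*} [Fintype V] (H : SimpleGraph V) : Prop :=
  ∀ x : V, m1At H x = m1 H

/-- `G` (an `n`-vertex graph) contains an `H`-factor: `⌊n / v(H)⌋` pairwise vertex-disjoint
copies of `H`. -/
def HasFactor {V : Type*} [Fintype V] (H : SimpleGraph V) {n : ℕ}
    (G : SimpleGraph (Fin n)) : Prop :=
  ∃ f : Fin (n / Fintype.card V) × V → Fin n, Function.Injective f ∧
    ∀ (i : Fin (n / Fintype.card V)) ⦃u v : V⦄, H.Adj u v → G.Adj (f (i, u)) (f (i, v))

open MeasureTheory Filter Topology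
section gmA
open scoped Classical

/-- weight of the set `W` under the `q`-random subset -/
noncomputable def gmMu {X : Type*} [Fintype X] (q : ℝ) (W : Finset X) : ℝ :=
  q ^ W.card * (1 - q) ^ (Fintype.card X - W.card)

/-- expectation of `f` under the `q`-random subset -/
noncomputable def gmEx {X : Type*} [Fintype X] (q : ℝ) (f : Finset X → ℝ) : ℝ :=
  ∑ W : Finset X, gmMu q W * f W

lemma gmMu_nonneg {X : Type*} [Fintype X] {q : ℝ} (h0 : 0 ≤ q) (h1 : q ≤ 1) (W : Finset X) :
    0 ≤ gmMu q W := by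
  unfold gmMu
  have : 0 ≤ 1 - q := by linarith
  positivity

lemma gmMu_sum {X : Type*} [Fintype X] (q : ℝ) : ∑ W : Finset X, gmMu q W = 1 := by
  have := Finset.sum_pow_mul_eq_add_pow q (1 - q) (Finset.univ : Finset X)
  simp only [Finset.powerset_univ, Finset.card_univ] at this
  unfold gmMu
  rw [this]; simp

lemma gmEx_mono {X : Type*} [Fintype X] {q : ℝ} (h0 : 0 ≤ q) (h1 : q ≤ 1)
    {f g : Finset X → ℝ} (h : ∀ W, f W ≤ g W) : gmEx q f ≤ gmEx q g :=
  Finset.sum_le_sum fun W _ => mul_le_mul_of_nonneg_left (h W) (gmMu_nonneg h0 h1 W)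

lemma gmEx_const {X : Type*} [Fintype X] (q c : ℝ) :
    gmEx q (fun _ : Finset X => c) = c := by
  unfold gmEx
  rw [← Finset.sum_mul, gmMu_sum, one_mul]

lemma gmEx_add {X : Type*} [Fintype X] (q : ℝ) (f g : Finset X → ℝ) :
    gmEx q (fun W => f W + g W) = gmEx q f + gmEx q g := by
  unfold gmEx
  simp [mul_add, Finset.sum_add_distrib]

lemma gmEx_mul_const {X : Type*} [Fintype X] (q c : ℝ) (f : Finset X → ℝ) :
    gmEx q (fun W => f W * c) = gmEx q f * c := by
  unfold gmEx
  rw [Finset.sum_mul]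
  simp [mul_assoc]

lemma gmMu_union {X : Type*} [Fintype X] [DecidableEq X] {q : ℝ} (h0 : 0 ≤ q) (h1 : q ≤ 1)
    (W B : Finset X) (hd : Disjoint W B) :
    gmMu q W * q ^ B.card ≤ gmMu q (W ∪ B) := by
  unfold gmMu
  rw [Finset.card_union_of_disjoint hd]
  have h2 : 0 ≤ 1 - q := by linarith
  have : (1 - q) ^ (Fintype.card X - W.card) ≤ (1 - q) ^ (Fintype.card X - (W.card + B.card)) :=
    pow_le_pow_of_le_one h2 (by linarith) (by omega)
  calc _ = q ^ (W.card + B.card) * (1 - q) ^ (Fintype.card X - W.card) := by ring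
    _ ≤ _ := by gcongr

/-- the union of a `q`-random and an `r`-random set -/
lemma gmEx_or {X : Type*} [Fintype X] [DecidableEq X] (q r : ℝ) (f : Finset X → ℝ) :
    gmEx q (fun W1 => gmEx r (fun W2 => f (W1 ∪ W2))) = gmEx (q + r - q * r) f := by
  unfold gmEx
  simp_rw [Finset.mul_sum]
  rw [← Finset.sum_product']
  rw [← Finset.sum_fiberwise (s := (Finset.univ ×ˢ Finset.univ : Finset (Finset X × Finset X)))
    (g := fun z => z.1 ∪ z.2)]
  refine Finset.sum_congr rfl fun Z _ => ?_
  have key : ∑ z ∈ (Finset.univ ×ˢ Finset.univ : Finset (Finset X × Finset X)) with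
      z.1 ∪ z.2 = Z, gmMu q z.1 * (gmMu r z.2 * f (z.1 ∪ z.2))
      = ∑ a ∈ Z.powerset.sigma (fun W1 => W1.powerset),
        gmMu q a.1 * (gmMu r ((Z \ a.1) ∪ a.2) * f Z) := by
    symm
    refine Finset.sum_bij' (fun a _ => (a.1, (Z \ a.1) ∪ a.2))
      (fun z _ => ⟨z.1, z.1 ∩ z.2⟩) ?_ ?_ ?_ ?_ ?_
    · rintro ⟨W, U⟩ h
      simp only [Finset.mem_sigma, Finset.mem_powerset] at h
      simp only [Finset.mem_filter, Finset.mem_product, Finset.mem_univ, true_and]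
      ext x
      have h1 := @h.1 x
      have h2 := @h.2 x
      simp only [Finset.mem_union, Finset.mem_sdiff]
      tauto
    · rintro ⟨W, U⟩ h
      simp only [Finset.mem_filter, Finset.mem_product, Finset.mem_univ, true_and] at h
      simp only [Finset.mem_sigma, Finset.mem_powerset]
      refine ⟨?_, Finset.inter_subset_left⟩
      rw [← h]; exact Finset.subset_union_left
    · rintro ⟨W, U⟩ h
      simp only [Finset.mem_sigma, Finset.mem_powerset] at h
      have : W ∩ (Z \ W ∪ U) = U := by
        ext x
        have h1 := @h.1 x
        have h2 := @h.2 x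
        simp only [Finset.mem_union, Finset.mem_sdiff, Finset.mem_inter]
        tauto
      simp [this]
    · rintro ⟨W, U⟩ h
      simp only [Finset.mem_filter, Finset.mem_product, Finset.mem_univ, true_and] at h
      have : Z \ W ∪ W ∩ U = U := by
        ext x
        rw [← h]
        simp only [Finset.mem_union, Finset.mem_sdiff, Finset.mem_inter]
        tauto
      simp [this]
    · rintro ⟨W, U⟩ h
      simp only [Finset.mem_sigma, Finset.mem_powerset] at h
      have : W ∪ (Z \ W ∪ U) = Z := by
        ext x
        have h1 := @h.1 x
        have h2 := @h.2 x
        simp only [Finset.mem_union, Finset.mem_sdiff]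
        tauto
      simp [this]
  rw [key, Finset.sum_sigma]
  have inner : ∀ W ∈ Z.powerset, ∑ U ∈ W.powerset, gmMu q W * (gmMu r ((Z \ W) ∪ U) * f Z)
      = (q ^ W.card * ((1 - q) * r) ^ (Z.card - W.card)) *
        (((1 - q) * (1 - r)) ^ (Fintype.card X - Z.card) * f Z) := by
    intro W hW
    rw [Finset.mem_powerset] at hW
    have hZ : Z.card ≤ Fintype.card X := Finset.card_le_univ Z
    have hWZ := Finset.card_le_card hW
    have e1 : ∀ U ∈ W.powerset, gmMu q W * (gmMu r ((Z \ W) ∪ U) * f Z) =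
        (r ^ U.card * (1 - r) ^ (W.card - U.card)) *
        ((q ^ W.card * ((1 - q) * r) ^ (Z.card - W.card)) *
        (((1 - q) * (1 - r)) ^ (Fintype.card X - Z.card) * f Z)) := by
      intro U hU
      rw [Finset.mem_powerset] at hU
      have hUW := Finset.card_le_card hU
      unfold gmMu
      rw [Finset.card_union_of_disjoint, Finset.card_sdiff_of_subset hW]
      · have a1 : Fintype.card X - W.card = (Fintype.card X - Z.card) + (Z.card - W.card) := by
          omega
        have a2 : Fintype.card X - (Z.card - W.card + U.card)
          = (Fintype.card X - Z.card) + (W.card - U.card) := by omega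
        rw [a1, a2]
        simp only [pow_add, mul_pow]
        ring
      · exact Finset.disjoint_of_subset_right hU Finset.sdiff_disjoint
    rw [Finset.sum_congr rfl e1, ← Finset.sum_mul, Finset.sum_pow_mul_eq_add_pow]
    simp
  rw [Finset.sum_congr rfl inner, ← Finset.sum_mul, Finset.sum_pow_mul_eq_add_pow]
  unfold gmMu
  have b1 : q + (1 - q) * r = q + r - q * r := by ring
  have b2 : (1 - q) * (1 - r) = 1 - (q + r - q * r) := by ring
  rw [b1, b2]; ring

lemma gmEx_anti {X : Type*} [Fintype X] [DecidableEq X] {q p : ℝ} (h0 : 0 ≤ q) (hqp : q ≤ p)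
    (h1 : p ≤ 1) (f : Finset X → ℝ) (hf : ∀ A B, A ⊆ B → f B ≤ f A) :
    gmEx p f ≤ gmEx q f := by
  rcases eq_or_lt_of_le (hqp.trans h1) with h | h
  · have : p = q := by linarith
    rw [this]
  · have hq : 0 < 1 - q := by linarith
    have e : p = q + (p - q) / (1 - q) - q * ((p - q) / (1 - q)) := by
      field_simp; ring
    have r0 : 0 ≤ (p - q) / (1 - q) := div_nonneg (by linarith) hq.le
    have r1 : (p - q) / (1 - q) ≤ 1 := by rw [div_le_one hq]; linarith
    conv_lhs => rw [e]
    rw [← gmEx_or]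
    refine gmEx_mono h0 h.le fun W => ?_
    calc _ ≤ gmEx ((p - q) / (1 - q)) (fun _ : Finset X => f W) :=
          gmEx_mono r0 r1 fun W2 => hf _ _ Finset.subset_union_left
      _ = _ := gmEx_const _ _

/-- probability of containing a given set -/
lemma gmEx_superset {X : Type*} [Fintype X] [DecidableEq X] (q : ℝ) (A : Finset X) :
    gmEx q (fun W => if A ⊆ W then 1 else 0) = q ^ A.card := by
  unfold gmEx
  simp only [mul_ite, mul_one, mul_zero]
  rw [← Finset.sum_filter]
  have : ∑ W with A ⊆ W, gmMu q W = ∑ U ∈ Aᶜ.powerset,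
      q ^ A.card * (q ^ U.card * (1 - q) ^ (Aᶜ.card - U.card)) := by
    symm
    refine Finset.sum_bij' (fun U _ => A ∪ U) (fun W _ => W \ A) ?_ ?_ ?_ ?_ ?_
    · intro U _
      simp
    · intro W _
      rw [Finset.mem_powerset]
      intro x; simp
    · intro U hU
      rw [Finset.mem_powerset] at hU
      ext x
      have := @hU x
      simp only [Finset.mem_compl] at this
      simp only [Finset.mem_sdiff, Finset.mem_union]
      tauto
    · intro W hW
      simp only [Finset.mem_filter, Finset.mem_univ, true_and] at hW
      exact Finset.union_sdiff_of_subset hW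
    · intro U hU
      rw [Finset.mem_powerset] at hU
      unfold gmMu
      rw [Finset.card_union_of_disjoint, Finset.card_compl, pow_add, Nat.sub_sub]
      · ring
      · exact Finset.disjoint_of_subset_right hU disjoint_compl_right
  rw [this, ← Finset.mul_sum, Finset.sum_pow_mul_eq_add_pow]
  simp

end gmA

open MeasureTheory Filter Topology
section gmB
open scoped Classical

lemma gm_round {X Ω : Type*} [Fintype X] [DecidableEq X] (G : Finset Ω) (T : Ω → Finset X)
    (κ q y t k N : ℝ) (hκ : 0 < κ) (hq : 0 < q) (hq1 : q ≤ 1) (hy : 1 ≤ y) (hk0 : 0 ≤ k)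
    (hN : 0 ≤ N)
    (hspread : ∀ A : Finset X, ((G.filter (fun ω => A ⊆ T ω)).card : ℝ) * κ ^ A.card ≤ N)
    (hk : ∀ ω ∈ G, ((T ω).card : ℝ) ≤ k) :
    ∃ T' : Finset X → Ω → Finset X,
      (∀ W, ∀ ω ∈ G, T' W ω ⊆ T ω ∧ ∃ ω' ∈ G, T' W ω = T ω' \ W) ∧
      gmEx q (fun W => ((G.filter (fun ω => t ≤ ((T' W ω).card : ℝ))).card : ℝ)) ≤
        N * (y ^ (-t) * Real.exp (k * (y / (κ * q)))) := by
  have hφ : ∀ W : Finset X, ∀ ω : Ω, ∃ ω' : Ω, ω ∈ G → (ω' ∈ G ∧ T ω' ⊆ W ∪ T ω ∧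
      ∀ ω₂ ∈ G, T ω₂ ⊆ W ∪ T ω → (T ω' \ W).card ≤ (T ω₂ \ W).card) := by
    intro W ω
    by_cases hω : ω ∈ G
    · obtain ⟨ω', h1, h2⟩ := Finset.exists_min_image (G.filter (fun ω' => T ω' ⊆ W ∪ T ω))
        (fun ω' => (T ω' \ W).card) ⟨ω, by simp [hω]⟩
      rw [Finset.mem_filter] at h1
      refine ⟨ω', fun _ => ⟨h1.1, h1.2, fun ω₂ h3 h4 => h2 _ ?_⟩⟩
      rw [Finset.mem_filter]; exact ⟨h3, h4⟩
    · exact ⟨ω, fun h => absurd h hω⟩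
  choose φ hφ using hφ
  have hsel : ∀ Z : Finset X, ∃ S : Finset X, (S.card : ℝ) ≤ k ∧
      ((∃ ω ∈ G, T ω ⊆ Z) → ∃ ω ∈ G, S = T ω ∧ T ω ⊆ Z) := by
    intro Z
    by_cases h : ∃ ω ∈ G, T ω ⊆ Z
    · obtain ⟨ω, h1, h2⟩ := h
      exact ⟨T ω, hk ω h1, fun _ => ⟨ω, h1, rfl, h2⟩⟩
    · exact ⟨∅, by simpa using hk0, fun h' => absurd h' h⟩
  choose S hSk hS using hsel
  refine ⟨fun W ω => T (φ W ω) \ W, ?_, ?_⟩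
  · intro W ω hω
    obtain ⟨h1, h2, h3⟩ := hφ W ω hω
    refine ⟨?_, φ W ω, h1, rfl⟩
    intro x hx
    rw [Finset.mem_sdiff] at hx
    have := h2 hx.1
    rw [Finset.mem_union] at this
    tauto
  set T' : Finset X → Ω → Finset X := fun W ω => T (φ W ω) \ W with hT'
  set ℬ : Finset X → Finset (Finset X) := fun W =>
    (G.filter (fun ω => t ≤ ((T' W ω).card : ℝ))).image (T' W) with hℬ
  have hsub : ∀ W, ∀ ω ∈ G, T' W ω ⊆ T ω := by
    intro W ω hω
    obtain ⟨h1, h2, h3⟩ := hφ W ω hω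
    intro x hx
    rw [hT', Finset.mem_sdiff] at hx
    have := h2 hx.1
    rw [Finset.mem_union] at this
    tauto
  have hdisj : ∀ W, ∀ B ∈ ℬ W, Disjoint W B := by
    intro W B hB
    rw [hℬ, Finset.mem_image] at hB
    obtain ⟨ω, _, rfl⟩ := hB
    exact Finset.disjoint_sdiff
  have hcont : ∀ W, ∀ B ∈ ℬ W, B ⊆ S (W ∪ B) ∧ t ≤ (B.card : ℝ) := by
    intro W B hB
    rw [hℬ, Finset.mem_image] at hB
    obtain ⟨ω, hω, rfl⟩ := hB
    rw [Finset.mem_filter] at hω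
    refine ⟨?_, hω.2⟩
    obtain ⟨h1, h2, h3⟩ := hφ W ω hω.1
    obtain ⟨ω', h4, h5, h6⟩ := hS (W ∪ T' W ω) ⟨φ W ω, h1, by
      intro x hx; simp only [hT', Finset.mem_union, Finset.mem_sdiff]; tauto⟩
    rw [h5]
    have h7 : T ω' \ W ⊆ T' W ω := by
      intro x hx
      rw [Finset.mem_sdiff] at hx
      have := h6 hx.1
      rw [Finset.mem_union] at this
      tauto
    have h8 : T ω' ⊆ W ∪ T ω := h6.trans
      (Finset.union_subset_union (Finset.Subset.refl _) (hsub W ω hω.1))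
    have h9 := Finset.eq_of_subset_of_card_le h7 (h3 ω' h4 h8)
    rw [← h9]
    exact Finset.sdiff_subset
  have hcard : ∀ W, ((G.filter (fun ω => t ≤ ((T' W ω).card : ℝ))).card : ℝ) ≤
      ∑ B ∈ ℬ W, N * (κ⁻¹) ^ B.card := by
    intro W
    rw [Finset.card_eq_sum_card_image (T' W)]
    push_cast
    refine Finset.sum_le_sum fun B hB => ?_
    have h1 : (((G.filter (fun ω => t ≤ ((T' W ω).card : ℝ))).filter
        (fun ω => T' W ω = B)).card : ℝ) ≤ ((G.filter (fun ω => B ⊆ T ω)).card : ℝ) := by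
      refine Nat.cast_le.2 (Finset.card_le_card ?_)
      intro ω hω
      simp only [Finset.mem_filter] at hω ⊢
      refine ⟨hω.1.1, ?_⟩
      rw [← hω.2]; exact hsub W ω hω.1.1
    refine h1.trans ?_
    rw [inv_pow, ← div_eq_mul_inv, le_div_iff₀ (by positivity)]
    exact hspread B
  calc gmEx q (fun W => ((G.filter (fun ω => t ≤ ((T' W ω).card : ℝ))).card : ℝ))
      ≤ gmEx q (fun W => ∑ B ∈ ℬ W, N * (κ⁻¹) ^ B.card) := gmEx_mono hq.le hq1 hcard
    _ = ∑ a ∈ (Finset.univ : Finset (Finset X)).sigma ℬ, gmMu q a.1 * (N * (κ⁻¹) ^ a.2.card) := by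
        unfold gmEx
        rw [Finset.sum_sigma]
        simp_rw [Finset.mul_sum]
    _ ≤ ∑ a ∈ (Finset.univ : Finset (Finset X)).sigma ℬ,
          gmMu q (a.1 ∪ a.2) * (N * ((κ * q)⁻¹) ^ a.2.card) := by
        refine Finset.sum_le_sum fun a ha => ?_
        rw [Finset.mem_sigma] at ha
        have h1 := gmMu_union hq.le hq1 a.1 a.2 (hdisj _ _ ha.2)
        have h2 : gmMu q a.1 ≤ gmMu q (a.1 ∪ a.2) * (q⁻¹) ^ a.2.card := by
          rw [inv_pow, ← div_eq_mul_inv, le_div_iff₀ (by positivity)]; exact h1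
        calc _ ≤ gmMu q (a.1 ∪ a.2) * (q⁻¹) ^ a.2.card * (N * (κ⁻¹) ^ a.2.card) := by
              gcongr
          _ = _ := by rw [mul_inv, mul_pow]; ring
    _ = ∑ b ∈ ((Finset.univ : Finset (Finset X)).sigma ℬ).image (fun a => (a.1 ∪ a.2, a.2)),
          gmMu q b.1 * (N * ((κ * q)⁻¹) ^ b.2.card) := by
        rw [Finset.sum_image]
        rintro ⟨W, B⟩ h ⟨W', B'⟩ h' heq
        simp only [Finset.coe_sigma, Set.mem_sigma_iff, Finset.mem_coe] at h h'
        simp only [Prod.mk.injEq] at heq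
        obtain ⟨h1, rfl⟩ := heq
        have d1 := hdisj _ _ h.2
        have d2 := hdisj _ _ h'.2
        have : W = W' := by
          rw [← Finset.union_sdiff_cancel_right d1, h1, Finset.union_sdiff_cancel_right d2]
        rw [this]
    _ ≤ ∑ b ∈ (Finset.univ : Finset (Finset X × Finset X)).filter
          (fun b => b.2 ⊆ S b.1 ∧ t ≤ (b.2.card : ℝ)),
          gmMu q b.1 * (N * ((κ * q)⁻¹) ^ b.2.card) := by
        refine Finset.sum_le_sum_of_subset_of_nonneg ?_ ?_
        · intro b hb
          rw [Finset.mem_image] at hb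
          obtain ⟨a, ha, rfl⟩ := hb
          rw [Finset.mem_sigma] at ha
          rw [Finset.mem_filter]
          exact ⟨Finset.mem_univ _, hcont _ _ ha.2⟩
        · intro b _ _
          have := gmMu_nonneg hq.le hq1 b.1
          positivity
    _ ≤ ∑ b ∈ (Finset.univ : Finset (Finset X × Finset X)).filter
          (fun b => b.2 ⊆ S b.1),
          gmMu q b.1 * (N * (y ^ (-t) * (y / (κ * q)) ^ b.2.card)) := by
        have hm : ∀ b : Finset X × Finset X, 0 ≤ gmMu q b.1 :=
          fun b => gmMu_nonneg hq.le hq1 b.1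
        have hy0 : 0 < y := by linarith
        refine (Finset.sum_le_sum (g := fun b : Finset X × Finset X =>
          gmMu q b.1 * (N * (y ^ (-t) * (y / (κ * q)) ^ b.2.card))) ?_).trans
          (Finset.sum_le_sum_of_subset_of_nonneg ?_ ?_)
        · intro b hb
          rw [Finset.mem_filter] at hb
          have h1 : 1 ≤ y ^ (-t) * y ^ b.2.card := by
            rw [← Real.rpow_natCast, ← Real.rpow_add hy0]
            exact Real.one_le_rpow hy (by linarith [hb.2.2])
          have h2 : y ^ (-t) * (y / (κ * q)) ^ b.2.card
              = (y ^ (-t) * y ^ b.2.card) * ((κ * q)⁻¹) ^ b.2.card := by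
            rw [div_eq_mul_inv, mul_pow]; ring
          refine mul_le_mul_of_nonneg_left (mul_le_mul_of_nonneg_left ?_ hN) (hm b)
          rw [h2]
          exact le_mul_of_one_le_left (by positivity) h1
        · intro b hb
          simp only [Finset.mem_filter] at hb ⊢
          exact ⟨hb.1, hb.2.1⟩
        · intro b _ _
          have := hm b
          have h3 : 0 ≤ y ^ (-t) := Real.rpow_nonneg hy0.le _
          positivity
    _ = ∑ Z : Finset X, gmMu q Z * (N * (y ^ (-t) * (y / (κ * q) + 1) ^ (S Z).card)) := by
        rw [Finset.sum_filter, Fintype.sum_prod_type]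
        refine Finset.sum_congr rfl fun Z _ => ?_
        rw [← Finset.sum_pow_mul_eq_add_pow, ← Finset.sum_filter]
        have : (Finset.univ.filter (fun B => B ⊆ S Z)) = (S Z).powerset := by
          ext; simp
        simp only [this, one_pow, mul_one, Finset.mul_sum]
    _ ≤ ∑ Z : Finset X, gmMu q Z * (N * (y ^ (-t) * Real.exp (k * (y / (κ * q))))) := by
        refine Finset.sum_le_sum fun Z _ => ?_
        have h0 := gmMu_nonneg hq.le hq1 Z
        have hy0 : 0 < y := by linarith
        have h3 : 0 ≤ y ^ (-t) := Real.rpow_nonneg hy0.le _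
        have h4 : 0 ≤ y / (κ * q) := by positivity
        have h5 : (y / (κ * q) + 1) ^ (S Z).card ≤ Real.exp (k * (y / (κ * q))) := by
          calc (y / (κ * q) + 1) ^ (S Z).card ≤ (Real.exp (y / (κ * q))) ^ (S Z).card :=
                pow_le_pow_left₀ (by positivity) (Real.add_one_le_exp _) _
            _ = Real.exp ((S Z).card * (y / (κ * q))) := by rw [Real.exp_nat_mul]
            _ ≤ _ := Real.exp_le_exp.2 (mul_le_mul_of_nonneg_right (hSk Z) h4)
        gcongr
    _ = _ := by rw [← Finset.sum_mul, gmMu_sum, one_mul]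

/-- one round: whp some hyperedge is contained in `W` up to fewer than `t` elements -/
lemma gm_one_round {X Ω : Type*} [Fintype X] [DecidableEq X] (G : Finset Ω) (hG : G.Nonempty)
    (T : Ω → Finset X)
    (κ q y t k : ℝ) (hκ : 0 < κ) (hq : 0 < q) (hq1 : q ≤ 1) (hy : 1 ≤ y) (hk0 : 0 ≤ k)
    (hspread : ∀ A : Finset X, ((G.filter (fun ω => A ⊆ T ω)).card : ℝ) * κ ^ A.card ≤ G.card)
    (hk : ∀ ω ∈ G, ((T ω).card : ℝ) ≤ k) :
    gmEx q (fun W => if ∃ ω ∈ G, ((T ω \ W).card : ℝ) < t then 0 else 1) ≤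
      y ^ (-t) * Real.exp (k * (y / (κ * q))) := by
  obtain ⟨T', h1, h2⟩ := gm_round G T κ q y t k G.card hκ hq hq1 hy hk0 (by positivity) hspread hk
  have hc : (0 : ℝ) < G.card := by exact_mod_cast hG.card_pos
  have h3 : gmEx q (fun W => (if ∃ ω ∈ G, ((T ω \ W).card : ℝ) < t then (0 : ℝ) else 1) * G.card)
      ≤ gmEx q (fun W => ((G.filter (fun ω => t ≤ ((T' W ω).card : ℝ))).card : ℝ)) := by
    refine gmEx_mono hq.le hq1 fun W => ?_
    split_ifs with h
    · simp
    · rw [one_mul, Finset.filter_true_of_mem]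
      intro ω hω
      obtain ⟨ω', h4, h5⟩ := (h1 W ω hω).2
      rw [h5]
      by_contra h6
      exact h ⟨ω', h4, not_le.1 h6⟩
  rw [gmEx_mul_const] at h3
  have h4 := h3.trans h2
  rw [mul_comm (G.card : ℝ)] at h4
  exact le_of_mul_le_mul_right h4 hc

lemma gm_iter {X Ω : Type*} [Fintype X] [DecidableEq X] 
    (κ q Y N : ℝ) (hκ : 0 < κ) (hq : 0 < q) (hq1 : q ≤ 1) (hY : Real.exp 1 ≤ Y) (hN : 0 ≤ N)
    (hL : Y ^ 2 ≤ κ * q) (J : ℕ) :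
    ∀ (G : Finset Ω) (T : Ω → Finset X) (k : ℝ),
    (∀ A : Finset X, ((G.filter (fun ω => A ⊆ T ω)).card : ℝ) * κ ^ A.card ≤ N) →
    (∀ ω ∈ G, ((T ω).card : ℝ) < k) → 0 ≤ k → k ≤ Y ^ J →
    gmEx (1 - (1 - q) ^ J) (fun W => (if ∃ ω ∈ G, T ω ⊆ W then 0 else 1) * (G.card : ℝ)) ≤
      J * (Real.exp 1 / Y * N) := by
  have hY1 : 1 ≤ Y := (Real.one_le_exp (by norm_num)).trans hY
  have hY0 : 0 < Y := by linarith
  induction J with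
  | zero =>
    intro G T k hs hk hk0 hkJ
    have : ∀ W : Finset X, (if ∃ ω ∈ G, T ω ⊆ W then (0:ℝ) else 1) * (G.card : ℝ) = 0 := by
      intro W
      rcases G.eq_empty_or_nonempty with h | ⟨ω, hω⟩
      · simp [h]
      · have h1 := hk ω hω
        have h2 : ((T ω).card : ℝ) < 1 := by simpa using h1.trans_le hkJ
        have h3 : (T ω).card = 0 := by
          have : (T ω).card < 1 := by exact_mod_cast h2
          omega
        rw [Finset.card_eq_zero] at h3
        rw [if_pos ⟨ω, hω, by rw [h3]; exact Finset.empty_subset _⟩, zero_mul]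
    simp only [this]
    rw [gmEx_const]; simp
  | succ J ih =>
    intro G T k hs hk hk0 hkJ
    set t : ℝ := max 1 (k / Y) with ht
    have ht1 : 1 ≤ t := le_max_left _ _
    have ht2 : k / Y ≤ t := le_max_right _ _
    obtain ⟨T', h1, h2⟩ := gm_round G T κ q Y t k N hκ hq hq1 hY1 hk0 hN hs
      (fun ω hω => (hk ω hω).le)
    have hr0 : 0 ≤ (1 - q) ^ J := pow_nonneg (by linarith) _
    have hr1 : (1 - q) ^ J ≤ 1 := pow_le_one₀ (by linarith) (by linarith)
    have e : 1 - (1 - q) ^ (J + 1) = q + (1 - (1 - q) ^ J) - q * (1 - (1 - q) ^ J) := by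
      rw [pow_succ]; ring
    rw [e, ← gmEx_or]
    have hb : Y ^ (-t) * Real.exp (k * (Y / (κ * q))) ≤ Real.exp 1 / Y := by
      have b1 : k * (Y / (κ * q)) ≤ t := by
        refine le_trans ?_ ht2
        rw [div_eq_mul_inv k]
        refine mul_le_mul_of_nonneg_left ?_ hk0
        rw [div_le_iff₀ (by positivity), inv_mul_eq_div, le_div_iff₀ hY0]
        nlinarith
      calc Y ^ (-t) * Real.exp (k * (Y / (κ * q))) ≤ Y ^ (-t) * Real.exp t := by
            gcongr
        _ = (Real.exp 1 / Y) ^ t := by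
            rw [Real.div_rpow (Real.exp_pos _).le hY0.le, Real.exp_one_rpow, Real.rpow_neg hY0.le]
            field_simp
        _ ≤ (Real.exp 1 / Y) ^ (1 : ℝ) := by
            refine Real.rpow_le_rpow_of_exponent_ge (by positivity) ?_ ht1
            rw [div_le_one hY0]; exact hY
        _ = _ := Real.rpow_one _
    have h3 : ∀ W1 : Finset X, gmEx (1 - (1 - q) ^ J) (fun W2 =>
        (if ∃ ω ∈ G, T ω ⊆ W1 ∪ W2 then (0 : ℝ) else 1) * (G.card : ℝ)) ≤
        J * (Real.exp 1 / Y * N) + ((G.filter (fun ω => t ≤ ((T' W1 ω).card : ℝ))).card : ℝ) := by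
      intro W1
      have h4 := ih (G.filter (fun ω => ¬ t ≤ ((T' W1 ω).card : ℝ))) (T' W1) t ?_ ?_ (by linarith) ?_
      · refine le_trans ?_ (add_le_add_left h4 _)
        rw [← gmEx_const (X := X) (1 - (1 - q) ^ J)
          ((G.filter (fun ω => t ≤ ((T' W1 ω).card : ℝ))).card : ℝ), ← gmEx_add]
        refine gmEx_mono (by linarith) (by linarith) fun W2 => ?_
        have hc : (G.card : ℝ) = ((G.filter (fun ω => ¬ t ≤ ((T' W1 ω).card : ℝ))).card : ℝ) +
          ((G.filter (fun ω => t ≤ ((T' W1 ω).card : ℝ))).card : ℝ) := by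
          rw [← Finset.card_filter_add_card_filter_not (s := G)
            (fun ω => t ≤ ((T' W1 ω).card : ℝ))]
          push_cast; ring
        by_cases h5 : ∃ ω ∈ G, T ω ⊆ W1 ∪ W2
        · rw [if_pos h5, zero_mul]
          split_ifs <;> positivity
        · rw [if_neg h5, if_neg, hc]
          · linarith
          · rintro ⟨ω, h6, h7⟩
            rw [Finset.mem_filter] at h6
            obtain ⟨ω', h8, h9⟩ := (h1 W1 ω h6.1).2
            refine h5 ⟨ω', h8, ?_⟩
            rw [h9] at h7
            intro x hx
            by_cases hxW : x ∈ W1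
            · exact Finset.mem_union_left _ hxW
            · exact Finset.mem_union_right _ (h7 (Finset.mem_sdiff.2 ⟨hx, hxW⟩))
      · intro A
        refine le_trans ?_ (hs A)
        gcongr
        intro ω hω
        simp only [Finset.mem_filter] at hω ⊢
        exact ⟨hω.1.1, hω.2.trans (h1 W1 ω hω.1.1).1⟩
      · intro ω hω
        rw [Finset.mem_filter] at hω
        exact not_le.1 hω.2
      · refine max_le (one_le_pow₀ hY1) ?_
        rw [div_le_iff₀ hY0]
        rwa [pow_succ] at hkJ
    calc _ ≤ gmEx q (fun W1 => J * (Real.exp 1 / Y * N) +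
          ((G.filter (fun ω => t ≤ ((T' W1 ω).card : ℝ))).card : ℝ)) :=
          gmEx_mono hq.le hq1 h3
      _ ≤ J * (Real.exp 1 / Y * N) + Real.exp 1 / Y * N := by
          rw [gmEx_add, gmEx_const]
          have := h2.trans (mul_le_mul_of_nonneg_left hb hN)
          linarith
      _ = _ := by push_cast; ring

lemma gm_iter' {X Ω : Type*} [Fintype X] [DecidableEq X] (G : Finset Ω) (hG : G.Nonempty)
    (T : Ω → Finset X)
    (κ q Y : ℝ) (hκ : 0 < κ) (hq : 0 < q) (hq1 : q ≤ 1) (hY : Real.exp 1 ≤ Y)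
    (hL : Y ^ 2 ≤ κ * q) (J : ℕ) (k : ℝ)
    (hs : ∀ A : Finset X, ((G.filter (fun ω => A ⊆ T ω)).card : ℝ) * κ ^ A.card ≤ G.card)
    (hk : ∀ ω ∈ G, ((T ω).card : ℝ) < k) (hk0 : 0 ≤ k) (hkJ : k ≤ Y ^ J) :
    gmEx (1 - (1 - q) ^ J) (fun W => if ∃ ω ∈ G, T ω ⊆ W then 0 else 1) ≤
      J * (Real.exp 1 / Y) := by
  have h := gm_iter κ q Y G.card hκ hq hq1 hY (by positivity) hL J G T k hs hk hk0 hkJ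
  rw [gmEx_mul_const, ← mul_assoc] at h
  exact le_of_mul_le_mul_right h (by exact_mod_cast hG.card_pos)

end gmB

open MeasureTheory Filter Topology
section gmC
open scoped Classical

lemma gm_seq_count {α : Type*} [Fintype α] (s : ℕ) :
    ∀ (B : Fin s → (Fin s → α) → Finset α) (b : Fin s → ℕ),
    (∀ i ρ ρ', (∀ j < i, ρ j = ρ' j) → B i ρ = B i ρ') →
    (∀ i ρ, (B i ρ).card ≤ b i) →
    ((Finset.univ : Finset (Fin s → α)).filter (fun ρ => ∀ i, ρ i ∈ B i ρ)).card ≤ ∏ i, b i := by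
  induction s with
  | zero =>
    intro B b _ _
    refine (Finset.card_filter_le _ _).trans ?_
    simp
  | succ s ih =>
    intro B b hB hb
    rcases isEmpty_or_nonempty α with hα | ⟨⟨a0⟩⟩
    · rw [Finset.card_eq_zero.2]
      · exact Nat.zero_le _
      · rw [Finset.filter_eq_empty_iff]
        intro ρ _ _
        exact hα.elim (ρ 0)
    set B0 : Finset α := B 0 (fun _ => a0) with hB0
    have hsub : ((Finset.univ : Finset (Fin (s+1) → α)).filter (fun ρ => ∀ i, ρ i ∈ B i ρ)) ⊆
        B0.biUnion (fun a => ((Finset.univ : Finset (Fin s → α)).filter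
          (fun ρ => ∀ i, ρ i ∈ B i.succ (Fin.cons a ρ : Fin (s+1) → α))).image
            (fun ρ => (Fin.cons a ρ : Fin (s+1) → α))) := by
      intro ρ hρ
      simp only [Finset.mem_filter, Finset.mem_univ, true_and] at hρ
      simp only [Finset.mem_biUnion, Finset.mem_image, Finset.mem_filter, Finset.mem_univ, true_and]
      refine ⟨ρ 0, ?_, Fin.tail ρ, ?_, Fin.cons_self_tail ρ⟩
      · rw [hB0, hB 0 (fun _ => a0) ρ (fun j hj => absurd hj (Fin.not_lt_zero j))]
        exact hρ 0
      · intro i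
        rw [Fin.cons_self_tail]
        exact hρ i.succ
    refine (Finset.card_le_card hsub).trans (Finset.card_biUnion_le.trans ?_)
    rw [Fin.prod_univ_succ]
    calc _ ≤ ∑ a ∈ B0, ∏ i : Fin s, b i.succ := by
          refine Finset.sum_le_sum fun a _ => Finset.card_image_le.trans ?_
          refine ih (fun i ρ => B i.succ (Fin.cons a ρ : Fin (s+1) → α)) (fun i => b i.succ) ?_ ?_
          · intro i ρ ρ' h
            refine hB _ _ _ ?_
            intro j
            refine Fin.cases ?_ ?_ j
            · intro _; simp
            · intro j hj
              simp only [Fin.cons_succ]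
              exact h j (Fin.succ_lt_succ_iff.1 hj)
          · intro i ρ
            exact hb _ _
      _ = B0.card * ∏ i : Fin s, b i.succ := by simp
      _ ≤ _ := Nat.mul_le_mul_right _ (hb 0 _)

lemma gm_perm_count {M : ℕ} (A : Finset (Fin M)) (g : Fin M → Fin M) :
    ((Finset.univ : Finset (Equiv.Perm (Fin M))).filter (fun τ => ∀ a ∈ A, τ a = g a)).card ≤
      (M - A.card).factorial := by
  rcases Finset.eq_empty_or_nonempty
    ((Finset.univ : Finset (Equiv.Perm (Fin M))).filter (fun τ => ∀ a ∈ A, τ a = g a)) with h | ⟨τ0, h0⟩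
  · rw [h]; simp
  · simp only [Finset.mem_filter, Finset.mem_univ, true_and] at h0
    have h1 : ((Finset.univ : Finset (Equiv.Perm (Fin M))).filter (fun τ => ∀ a ∈ A, τ a = g a)).card
        ≤ ((Finset.univ : Finset (Equiv.Perm (Fin M))).filter
          (fun τ => ∀ a, ¬ (a ∉ A) → τ a = a)).card := by
      refine Finset.card_le_card_of_injOn (fun τ => τ0⁻¹ * τ) ?_ ?_
      · intro τ hτ
        simp only [Finset.coe_filter, Finset.mem_univ, true_and, Set.mem_ofPred_eq, not_not] at hτ ⊢
        intro a ha
        rw [Equiv.Perm.mul_apply, hτ a ha, ← h0 a ha]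
        exact Equiv.symm_apply_apply τ0 a
      · intro τ _ τ' _ h
        exact mul_left_cancel h
    refine h1.trans (le_of_eq ?_)
    rw [← Fintype.card_subtype, Fintype.card_congr
      (Equiv.Perm.subtypeEquivSubtypePerm (fun a => a ∉ A)).symm, Fintype.card_perm]
    congr 1
    rw [Fintype.card_subtype_compl]
    simp

lemma gm_factorial_bound (M : ℕ) : ∀ d ≤ M,
    ((M - d).factorial : ℝ) * (M : ℝ) ^ d ≤ M.factorial * Real.exp 1 ^ d := by
  induction M with
  | zero => intro d hd; obtain rfl : d = 0 := by omega
            simp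
  | succ M ih =>
    intro d hd
    rcases d with _ | d
    · simp
    · have h := ih d (by omega)
      have e1 : M + 1 - (d + 1) = M - d := by omega
      rw [e1, Nat.factorial_succ]
      have h2 : ((M : ℝ) + 1) ^ d ≤ (M : ℝ) ^ d * Real.exp 1 := by
        rcases Nat.eq_zero_or_pos M with rfl | hM
        · obtain rfl : d = 0 := by omega
          simp
        · have hM' : (0 : ℝ) < M := by exact_mod_cast hM
          have h3 : (M : ℝ) + 1 ≤ M * Real.exp (1 / M) := by
            have := Real.add_one_le_exp (1 / (M : ℝ))
            calc (M : ℝ) + 1 = M * (1 / M + 1) := by field_simp; ring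
              _ ≤ _ := by gcongr
          calc ((M : ℝ) + 1) ^ d ≤ (M * Real.exp (1 / M)) ^ d := by gcongr
            _ = (M : ℝ) ^ d * Real.exp (d * (1 / M)) := by rw [mul_pow, ← Real.exp_nat_mul]
            _ ≤ _ := by
              gcongr
              rw [mul_one_div, div_le_one hM']
              exact_mod_cast (by omega : d ≤ M)
      push_cast
      calc ((M - d).factorial : ℝ) * ((M : ℝ) + 1) ^ (d + 1)
          = ((M - d).factorial : ℝ) * ((M : ℝ) + 1) ^ d * (M + 1) := by ring
        _ ≤ ((M - d).factorial : ℝ) * ((M : ℝ) ^ d * Real.exp 1) * (M + 1) := by gcongr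
        _ = (((M - d).factorial : ℝ) * (M : ℝ) ^ d) * Real.exp 1 * (M + 1) := by ring
        _ ≤ (M.factorial * Real.exp 1 ^ d) * Real.exp 1 * (M + 1) := by gcongr
        _ = _ := by ring

/-- rank bound for sets of edges -/
lemma gm_rank {V : Type*} [Fintype V] (s : ℕ) (π : V → Fin s) (m : ℝ) (hm : 0 ≤ m)
    (E : Finset (Sym2 V))
    (hE : ∀ I : Finset (Fin s), I.Nonempty →
      ((E.filter (fun e => ∀ v ∈ e, π v ∈ I)).card : ℝ) ≤ m * ((I.card : ℝ) - 1))
    (F : Finset (Sym2 V)) (hF : F ⊆ E) (Q : SimpleGraph (Fin s))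
    (hQ : ∀ u v, s(u, v) ∈ F → Q.Reachable (π u) (π v)) :
    (F.card : ℝ) ≤ m * ((Finset.univ.filter (fun i => ∃ j < i, Q.Reachable j i)).card : ℝ) := by
  have h1 : F ⊆ (Finset.univ : Finset Q.ConnectedComponent).biUnion (fun c =>
      E.filter (fun e => ∀ v ∈ e, π v ∈ Finset.univ.filter
        (fun i => Q.connectedComponentMk i = c))) := by
    intro e he
    induction e using Sym2.ind with
    | _ u v =>
      have hr := hQ u v he
      simp only [Finset.mem_biUnion, Finset.mem_univ, true_and, Finset.mem_filter]
      refine ⟨Q.connectedComponentMk (π u), hF he, ?_⟩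
      intro w hw
      rw [Sym2.mem_iff] at hw
      rcases hw with rfl | rfl
      · rfl
      · exact (SimpleGraph.ConnectedComponent.eq.2 hr).symm
  have h2 : (F.card : ℝ) ≤ ∑ c : Q.ConnectedComponent,
      m * (((Finset.univ.filter (fun i => Q.connectedComponentMk i = c)).card : ℝ) - 1) := by
    have := (Finset.card_le_card h1).trans Finset.card_biUnion_le
    have h3 : (F.card : ℝ) ≤ ∑ c : Q.ConnectedComponent, ((E.filter (fun e => ∀ v ∈ e, π v ∈
        Finset.univ.filter (fun i => Q.connectedComponentMk i = c))).card : ℝ) := by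
      exact_mod_cast this
    refine h3.trans (Finset.sum_le_sum fun c _ => hE _ ?_)
    obtain ⟨i, hi⟩ := c.exists_rep
    exact ⟨i, Finset.mem_filter.2 ⟨Finset.mem_univ _, hi⟩⟩
  refine h2.trans ?_
  rw [← Finset.mul_sum]
  refine mul_le_mul_of_nonneg_left ?_ hm
  rw [Finset.sum_sub_distrib]
  have h4 : ∑ c : Q.ConnectedComponent,
      ((Finset.univ.filter (fun i => Q.connectedComponentMk i = c)).card : ℝ) = s := by
    have := Finset.card_eq_sum_card_fiberwise (f := Q.connectedComponentMk)
      (s := (Finset.univ : Finset (Fin s))) (t := Finset.univ) (fun _ _ => Finset.mem_coe.2 (Finset.mem_univ _))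
    rw [Finset.card_univ, Fintype.card_fin] at this
    exact_mod_cast this.symm
  rw [h4]
  have h5 : (Finset.univ.filter (fun i : Fin s => ¬ ∃ j < i, Q.Reachable j i)).card ≤
      Fintype.card Q.ConnectedComponent := by
    rw [← Finset.card_univ]
    refine Finset.card_le_card_of_injOn Q.connectedComponentMk (fun _ _ => Finset.mem_coe.2 (Finset.mem_univ _)) ?_
    intro i hi j hj hij
    simp only [Finset.coe_filter, Finset.mem_univ, true_and, Set.mem_ofPred_eq, not_exists,
      not_and] at hi hj
    have hr := SimpleGraph.ConnectedComponent.eq.1 hij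
    rcases lt_trichotomy i j with h | h | h
    · exact absurd hr (hj i h)
    · exact h
    · exact absurd hr.symm (hi j h)
  have h6 := Finset.card_filter_add_card_filter_not (s := (Finset.univ : Finset (Fin s)))
    (fun i : Fin s => ∃ j < i, Q.Reachable j i)
  rw [Finset.card_univ, Fintype.card_fin] at h6
  have h7 : (s : ℝ) = ((Finset.univ.filter (fun i : Fin s => ∃ j < i, Q.Reachable j i)).card : ℝ) +
    ((Finset.univ.filter (fun i : Fin s => ¬ ∃ j < i, Q.Reachable j i)).card : ℝ) := by
    exact_mod_cast h6.symm
  have h8 : ((Finset.univ.filter (fun i : Fin s => ¬ ∃ j < i, Q.Reachable j i)).card : ℝ) ≤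
      Fintype.card Q.ConnectedComponent := by exact_mod_cast h5
  simp only [Finset.sum_const, Finset.card_univ, nsmul_eq_mul, mul_one]
  linarith


/-- the edges to be present for the arrangement `σ` -/
noncomputable def gmS {V : Type*} {M n s : ℕ} (π : V → Fin s) (E : Finset (Sym2 V))
    (f : Fin M × V → Fin n) (σ : Fin s → Equiv.Perm (Fin M)) : Finset (Sym2 (Fin n)) :=
  ((Finset.univ : Finset (Fin M)) ×ˢ E).image
    (fun z => z.2.map (fun v => f (σ (π v) z.1, v)))

lemma gmS_card {V : Type*} {M n s : ℕ} (π : V → Fin s) (E : Finset (Sym2 V))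
    (f : Fin M × V → Fin n) (σ : Fin s → Equiv.Perm (Fin M)) :
    (gmS π E f σ).card ≤ M * E.card := by
  refine Finset.card_image_le.trans ?_
  simp

lemma gm_spread {V : Type*} [Fintype V] {M n s : ℕ} (π : V → Fin s) (m : ℝ) (hm : 0 < m)
    (E : Finset (Sym2 V)) (hM : Real.exp 1 ≤ M)
    (hE : ∀ I : Finset (Fin s), I.Nonempty →
      ((E.filter (fun e => ∀ v ∈ e, π v ∈ I)).card : ℝ) ≤ m * ((I.card : ℝ) - 1))
    (f : Fin M × V → Fin n) (hf : Function.Injective f) (A : Finset (Sym2 (Fin n))) :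
    (((Finset.univ : Finset (Fin s → Equiv.Perm (Fin M))).filter
      (fun σ => A ⊆ gmS π E f σ)).card : ℝ) * (((M : ℝ) / Real.exp 1) ^ (1 / m)) ^ A.card ≤
      ((Finset.univ : Finset (Fin s → Equiv.Perm (Fin M))).card : ℝ) := by
  rcases Finset.eq_empty_or_nonempty ((Finset.univ : Finset (Fin s → Equiv.Perm (Fin M))).filter
      (fun σ => A ⊆ gmS π E f σ)) with h | ⟨σ0, h0⟩
  · rw [h]; simp
  simp only [Finset.mem_filter, Finset.mem_univ, true_and] at h0
  set F : Fin M → Finset (Sym2 V) := fun k =>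
    E.filter (fun e => e.map (fun v => f (σ0 (π v) k, v)) ∈ A) with hFdef
  set Q : Fin M → SimpleGraph (Fin s) := fun k => SimpleGraph.fromRel
    (fun i j => ∃ u v, s(u, v) ∈ F k ∧ π u = i ∧ π v = j) with hQdef
  have hQr : ∀ k u v, s(u, v) ∈ F k → (Q k).Reachable (π u) (π v) := by
    intro k u v huv
    by_cases h : π u = π v
    · rw [h]
    · refine SimpleGraph.Adj.reachable ?_
      rw [hQdef, SimpleGraph.fromRel_adj]
      exact ⟨h, Or.inl ⟨u, v, huv, rfl, rfl⟩⟩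
  -- cardinality of `A`
  have hAF : (A.card : ℝ) ≤ ∑ k, ((F k).card : ℝ) := by
    have h1 : A ⊆ (Finset.univ : Finset (Fin M)).biUnion (fun k => (F k).image
        (fun e => e.map (fun v => f (σ0 (π v) k, v)))) := by
      intro a ha
      have h2 := h0 ha
      rw [gmS, Finset.mem_image] at h2
      obtain ⟨⟨k, e⟩, h3, h4⟩ := h2
      simp only [Finset.mem_product, Finset.mem_univ, true_and] at h3
      simp only at h4
      simp only [Finset.mem_biUnion, Finset.mem_univ, true_and, Finset.mem_image]
      refine ⟨k, e, ?_, h4⟩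
      rw [hFdef, Finset.mem_filter]
      refine ⟨h3, ?_⟩
      rw [h4]; exact ha
    have h2 := (Finset.card_le_card h1).trans (Finset.card_biUnion_le.trans
      (Finset.sum_le_sum fun k _ => Finset.card_image_le))
    exact_mod_cast h2
  set R : Fin M → Finset (Fin s) := fun k =>
    Finset.univ.filter (fun i => ∃ j < i, (Q k).Reachable j i) with hRdef
  have hFR : ∀ k, ((F k).card : ℝ) ≤ m * ((R k).card : ℝ) := fun k => by
    have := gm_rank s π m hm.le E hE (F k) (Finset.filter_subset _ _) (Q k) (hQr k)
    convert this
  set A' : Fin s → Finset (Fin M) := fun i =>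
    Finset.univ.filter (fun k => ∃ j < i, (Q k).Reachable j i) with hA'
  have hsum : ∑ k, (R k).card = ∑ i, (A' i).card := by
    simp only [hRdef, hA', Finset.card_filter]
    exact Finset.sum_comm
  have hpar : ∀ (i : Fin s) (k : Fin M), ∃ j : Fin s,
      (∃ j < i, (Q k).Reachable j i) → j < i ∧ (Q k).Reachable j i := by
    intro i k
    by_cases h : ∃ j < i, (Q k).Reachable j i
    · obtain ⟨j, hj⟩ := h
      exact ⟨j, fun _ => hj⟩
    · exact ⟨i, fun h' => absurd h' h⟩
  choose par hpar using hpar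
  have hcount : ((Finset.univ : Finset (Fin s → Equiv.Perm (Fin M))).filter
      (fun σ => A ⊆ gmS π E f σ)).card ≤ ∏ i, (M - (A' i).card).factorial := by
    refine le_trans ?_ (gm_seq_count s
      (fun i (ρ : Fin s → Equiv.Perm (Fin M)) => (Finset.univ : Finset (Equiv.Perm (Fin M))).filter
        (fun τ => ∀ k ∈ A' i, τ k = ρ (par i k) k))
      (fun i => (M - (A' i).card).factorial) ?_ ?_)
    · refine Finset.card_le_card_of_injOn (fun σ i => (σ i)⁻¹ * σ0 i) ?_ ?_
      · intro σ hσ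
        simp only [Finset.coe_filter, Finset.mem_univ, true_and, Set.mem_ofPred_eq] at hσ
        have hadj : ∀ k u v, s(u, v) ∈ F k →
            ((σ (π u))⁻¹ * σ0 (π u)) k = ((σ (π v))⁻¹ * σ0 (π v)) k := by
          intro k u v huv
          rw [hFdef, Finset.mem_filter] at huv
          have h2 := hσ huv.2
          rw [gmS, Finset.mem_image] at h2
          obtain ⟨⟨k', e'⟩, h3, h4⟩ := h2
          induction e' using Sym2.ind with
          | _ u' v' =>
            simp only [Sym2.map_mk] at h4
            rw [Sym2.eq_iff] at h4
            have key : ∀ w w' : V, f (σ (π w') k', w') = f (σ0 (π w) k, w) →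
                ((σ (π w))⁻¹ * σ0 (π w)) k = k' := by
              intro w w' hw
              have h5 := hf hw
              simp only [Prod.mk.injEq] at h5
              obtain ⟨h6, rfl⟩ := h5
              rw [Equiv.Perm.mul_apply, ← h6]
              exact Equiv.symm_apply_apply _ _
            rcases h4 with ⟨h5, h6⟩ | ⟨h5, h6⟩
            · rw [key u u' h5, key v v' h6]
            · rw [key v u' h5, key u v' h6]
        have hreach : ∀ k i j, (Q k).Reachable i j →
            ((σ i)⁻¹ * σ0 i) k = ((σ j)⁻¹ * σ0 j) k := by
          intro k i j hr
          refine hr.elim fun w => ?_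
          induction w with
          | nil => rfl
          | cons h _ ih =>
            rename_i a b c _
            have hbc := ih ⟨by assumption⟩
            rw [← hbc]
            rw [hQdef, SimpleGraph.fromRel_adj] at h
            rcases h.2 with ⟨u, v, h1, rfl, rfl⟩ | ⟨u, v, h1, rfl, rfl⟩
            · exact hadj k u v h1
            · exact (hadj k u v h1).symm
        simp only [Finset.coe_filter, Finset.mem_univ, true_and, Set.mem_ofPred_eq,
          Finset.mem_filter]
        intro i k hk
        rw [hA', Finset.mem_filter] at hk
        exact (hreach k _ _ (hpar i k hk.2).2).symm
      · intro σ _ σ' _ h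
        funext i
        have h1 := congrFun h i
        simp only at h1
        exact inv_injective (mul_right_cancel h1)
    · intro i ρ ρ' h
      ext τ
      simp only [Finset.mem_filter, Finset.mem_univ, true_and]
      refine forall₂_congr fun k hk => ?_
      rw [hA', Finset.mem_filter] at hk
      rw [h _ (hpar i k hk.2).1]
    · intro i ρ
      exact gm_perm_count (A' i) (fun k => ρ (par i k) k)
  set D : ℕ := ∑ i, (A' i).card with hD
  have hMpos : (0 : ℝ) < M := (Real.exp_pos 1).trans_le hM
  have hAD : (A.card : ℝ) ≤ m * D := by
    refine hAF.trans ((Finset.sum_le_sum fun k _ => hFR k).trans ?_)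
    rw [← Finset.mul_sum, ← hsum]
    push_cast
    exact le_rfl
  have h1 : (((M : ℝ) / Real.exp 1) ^ (1 / m)) ^ A.card ≤ ((M : ℝ) / Real.exp 1) ^ D := by
    rw [← Real.rpow_natCast, ← Real.rpow_mul (by positivity), ← Real.rpow_natCast]
    refine Real.rpow_le_rpow_of_exponent_le ?_ ?_
    · rw [le_div_iff₀ (Real.exp_pos 1)]; linarith
    · rw [one_div_mul_eq_div, div_le_iff₀ hm]; linarith
  have h2 : (((Finset.univ : Finset (Fin s → Equiv.Perm (Fin M))).filter
      (fun σ => A ⊆ gmS π E f σ)).card : ℝ) ≤ ∏ i, ((M - (A' i).card).factorial : ℝ) := by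
    exact_mod_cast hcount
  have h3 : ((Finset.univ : Finset (Fin s → Equiv.Perm (Fin M))).card : ℝ) =
      ∏ _i : Fin s, (M.factorial : ℝ) := by
    rw [Finset.card_univ]
    simp [Fintype.card_perm]
  have h4 : ((M : ℝ) / Real.exp 1) ^ D = ∏ i, ((M : ℝ) / Real.exp 1) ^ (A' i).card := by
    rw [hD, Finset.prod_pow_eq_pow_sum]
  calc _ ≤ (∏ i, ((M - (A' i).card).factorial : ℝ)) * ((M : ℝ) / Real.exp 1) ^ D := by
        gcongr
    _ = ∏ i, (((M - (A' i).card).factorial : ℝ) * ((M : ℝ) / Real.exp 1) ^ (A' i).card) := by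
        rw [h4, Finset.prod_mul_distrib]
    _ ≤ ∏ _i : Fin s, (M.factorial : ℝ) := by
        refine Finset.prod_le_prod (fun i _ => by positivity) fun i _ => ?_
        have h5 : (A' i).card ≤ M := by
          simpa using Finset.card_le_univ (A' i)
        have h6 := gm_factorial_bound M _ h5
        rw [div_pow, ← mul_div_assoc, div_le_iff₀ (by positivity)]
        exact h6
    _ = _ := h3.symm

end gmC

open MeasureTheory Filter Topology
section gmD
open scoped Classical

/-- the edges of `H` as a finset -/
noncomputable def gmE {V : Type*} [Fintype V] (H : SimpleGraph V) : Finset (Sym2 V) :=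
  Finset.univ.filter (fun e => e ∈ H.edgeSet)

/-- number of edges of `H` inside `I` -/
noncomputable def gmC {V : Type*} [Fintype V] (H : SimpleGraph V) (I : Finset V) : ℕ :=
  ((gmE H).filter (fun e => ∀ v ∈ e, v ∈ I)).card

lemma gm_sub_edge {V : Type*} [Fintype V] (H : SimpleGraph V) (H' : H.Subgraph) :
    H'.edgeSet.ncard ≤ gmC H H'.verts.toFinset := by
  rw [gmC, ← Set.ncard_coe_finset]
  refine Set.ncard_le_ncard ?_ (Finset.finite_toSet _)
  intro e he
  simp only [gmE, Finset.coe_filter, Finset.mem_filter, Finset.mem_univ, true_and,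
    Set.mem_ofPred_eq]
  refine ⟨H'.edgeSet_subset he, ?_⟩
  intro v hv
  rw [Set.mem_toFinset]
  exact H'.mem_verts_of_mem_edge he hv

lemma gm_bdd {V : Type*} [Fintype V] (H : SimpleGraph V) :
    {x : ℝ | ∃ H' : H.Subgraph, 1 < H'.verts.ncard ∧
    x = (H'.edgeSet.ncard : ℝ) / ((H'.verts.ncard : ℝ) - 1)}.Finite := by
  refine Set.Finite.subset (Set.finite_range (fun H' : H.Subgraph =>
    (H'.edgeSet.ncard : ℝ) / ((H'.verts.ncard : ℝ) - 1))) ?_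
  rintro x ⟨H', _, rfl⟩
  exact ⟨H', rfl⟩

lemma gm_induced {V : Type*} [Fintype V] (H : SimpleGraph V) (I : Finset V) :
    ∃ H' : H.Subgraph, H'.verts = I ∧ H'.edgeSet.ncard = gmC H I := by
  refine ⟨(⊤ : H.Subgraph).induce I, rfl, ?_⟩
  rw [gmC, ← Set.ncard_coe_finset]
  congr 1
  ext e
  induction e using Sym2.ind with
  | _ u v =>
    simp only [gmE, Finset.coe_filter, Finset.mem_filter, Finset.mem_univ, true_and,
      Set.mem_ofPred_eq, SimpleGraph.Subgraph.mem_edgeSet, SimpleGraph.mem_edgeSet, Sym2.mem_iff]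
    simp only [SimpleGraph.Subgraph.induce_adj, Finset.mem_coe, SimpleGraph.Subgraph.top_adj]
    constructor
    · rintro ⟨h1, h2, h3⟩
      refine ⟨h3, ?_⟩
      rintro w (rfl | rfl) <;> assumption
    · rintro ⟨h1, h2⟩
      exact ⟨h2 u (Or.inl rfl), h2 v (Or.inr rfl), h1⟩

lemma gm_card_one {V : Type*} [Fintype V] (H : SimpleGraph V) (I : Finset V) (hI : I.card ≤ 1) :
    gmC H I = 0 := by
  rw [gmC, Finset.card_eq_zero, Finset.filter_eq_empty_iff]
  intro e he h
  induction e using Sym2.ind with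
  | _ u v =>
    simp only [gmE, Finset.mem_filter, Finset.mem_univ, true_and, SimpleGraph.mem_edgeSet] at he
    exact he.ne (Finset.card_le_one.1 hI u (h u (by simp)) v (h v (by simp)))

lemma gm_le_m1 {V : Type*} [Fintype V] (H : SimpleGraph V) (I : Finset V) (hI : I.Nonempty) :
    (gmC H I : ℝ) ≤ m1 H * ((I.card : ℝ) - 1) := by
  rcases Nat.lt_or_ge 1 I.card with h | h
  · obtain ⟨H', h1, h2⟩ := gm_induced H I
    have h3 : (H'.edgeSet.ncard : ℝ) / ((H'.verts.ncard : ℝ) - 1) ≤ m1 H :=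
      le_csSup (gm_bdd H).bddAbove ⟨H', by rw [h1, Set.ncard_coe_finset]; exact h, rfl⟩
    have h4 : (1 : ℝ) < I.card := by exact_mod_cast h
    rw [h1, h2, Set.ncard_coe_finset, div_le_iff₀ (by linarith)] at h3
    exact h3
  · have h1 := hI.card_pos
    have h2 : I.card = 1 := by omega
    rw [gm_card_one H I h, h2]; simp

lemma gm_m1_attained {V : Type*} [Fintype V] (H : SimpleGraph V) (hE : H.edgeSet.Nonempty) :
    1 ≤ m1 H ∧ ∃ I : Finset V, 1 < I.card ∧ (gmC H I : ℝ) = m1 H * ((I.card : ℝ) - 1) := by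
  have hone : 1 ≤ m1 H := by
    obtain ⟨e, he⟩ := hE
    induction e using Sym2.ind with
    | _ u v =>
      have huv : u ≠ v := SimpleGraph.Adj.ne he
      have h := gm_le_m1 H {u, v} (by simp)
      rw [Finset.card_pair huv] at h
      have h2 : 1 ≤ gmC H {u, v} := by
        rw [gmC, Nat.one_le_iff_ne_zero, Finset.card_ne_zero]
        refine ⟨s(u, v), ?_⟩
        simp only [gmE, Finset.mem_filter, Finset.mem_univ, true_and]
        refine ⟨he, ?_⟩
        intro w hw
        simpa using hw
      have h3 : (1 : ℝ) ≤ gmC H {u, v} := by exact_mod_cast h2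
      push_cast at h
      linarith
  refine ⟨hone, ?_⟩
  have hne : {x : ℝ | ∃ H' : H.Subgraph, 1 < H'.verts.ncard ∧
    x = (H'.edgeSet.ncard : ℝ) / ((H'.verts.ncard : ℝ) - 1)}.Nonempty := by
    by_contra h
    rw [Set.not_nonempty_iff_eq_empty] at h
    rw [m1, h, Real.sSup_empty] at hone
    linarith
  obtain ⟨H', h1, h2⟩ := hne.csSup_mem (gm_bdd H)
  have h3 : m1 H = (H'.edgeSet.ncard : ℝ) / ((H'.verts.ncard : ℝ) - 1) := h2
  have h4 : H'.verts.ncard = H'.verts.toFinset.card := Set.ncard_eq_toFinset_card' _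
  refine ⟨H'.verts.toFinset, by rw [← h4]; exact h1, ?_⟩
  have h5 : (1 : ℝ) < H'.verts.toFinset.card := by rw [← h4]; exact_mod_cast h1
  refine le_antisymm (gm_le_m1 H _ ?_) ?_
  · rw [← Finset.card_pos, ← h4]; omega
  · rw [h3, h4, div_mul_cancel₀ _ (by linarith)]
    exact_mod_cast gm_sub_edge H H'

lemma gm_exists_loose {V : Type*} [Fintype V] (H : SimpleGraph V) (hE : H.edgeSet.Nonempty)
    (hnb : ¬ VertexOneBalanced H) :
    ∃ x : V, ∀ I : Finset V, x ∈ I → 1 < I.card → (gmC H I : ℝ) < m1 H * ((I.card : ℝ) - 1) := by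
  unfold VertexOneBalanced at hnb
  push Not at hnb
  obtain ⟨x, hx⟩ := hnb
  have hsub : {r : ℝ | ∃ H' : H.Subgraph, x ∈ H'.verts ∧ 1 < H'.verts.ncard ∧
      r = (H'.edgeSet.ncard : ℝ) / ((H'.verts.ncard : ℝ) - 1)} ⊆
      {x : ℝ | ∃ H' : H.Subgraph, 1 < H'.verts.ncard ∧
        x = (H'.edgeSet.ncard : ℝ) / ((H'.verts.ncard : ℝ) - 1)} := by
    rintro r ⟨H', _, h2⟩
    exact ⟨H', h2⟩
  have hne : {r : ℝ | ∃ H' : H.Subgraph, x ∈ H'.verts ∧ 1 < H'.verts.ncard ∧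
      r = (H'.edgeSet.ncard : ℝ) / ((H'.verts.ncard : ℝ) - 1)}.Nonempty := by
    refine ⟨_, ⊤, by simp, ?_, rfl⟩
    obtain ⟨e, he⟩ := hE
    induction e using Sym2.ind with
    | _ u v =>
      have huv : u ≠ v := SimpleGraph.Adj.ne he
      rw [SimpleGraph.Subgraph.verts_top, Set.ncard_univ, Nat.card_eq_fintype_card]
      exact Fintype.one_lt_card_iff.2 ⟨u, v, huv⟩
  have hle : m1At H x ≤ m1 H := csSup_le_csSup (gm_bdd H).bddAbove hne hsub
  have hlt := lt_of_le_of_ne hle hx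
  refine ⟨x, fun I hxI hI => ?_⟩
  obtain ⟨H', h1, h2⟩ := gm_induced H I
  have h3 : (H'.edgeSet.ncard : ℝ) / ((H'.verts.ncard : ℝ) - 1) ≤ m1At H x :=
    le_csSup ((gm_bdd H).subset hsub).bddAbove
      ⟨H', by rw [h1]; exact hxI, by rw [h1, Set.ncard_coe_finset]; exact hI, rfl⟩
  have h4 : (1 : ℝ) < I.card := by exact_mod_cast hI
  have h5 := h3.trans_lt hlt
  rw [h1, h2, Set.ncard_coe_finset, div_lt_iff₀ (by linarith)] at h5
  exact h5

lemma gm_partition {V : Type*} [Fintype V] (H : SimpleGraph V) (hE : H.edgeSet.Nonempty) (x : V)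
    (hx : ∀ I : Finset V, x ∈ I → 1 < I.card → (gmC H I : ℝ) < m1 H * ((I.card : ℝ) - 1)) :
    ∃ π : V → Fin (Fintype.card V), (∀ v, π v = π x → v = x) ∧ ∃ m' : ℝ, 0 < m' ∧ m' < m1 H ∧
      ∀ I : Finset (Fin (Fintype.card V)), I.Nonempty →
        ((((gmE H).filter (fun e => ¬ (e.map π).IsDiag)).filter
          (fun e => ∀ v ∈ e, π v ∈ I)).card : ℝ) ≤ m' * ((I.card : ℝ) - 1) := by
  obtain ⟨hm1, -⟩ := gm_m1_attained H hE
  set m := m1 H with hm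
  have hm0 : 0 < m := by linarith
  set s := Fintype.card V with hs
  let fib : (V → Fin s) → Fin s → Finset V := fun π i => Finset.univ.filter (fun v => π v = i)
  let valid : (V → Fin s) → Prop := fun π => ∀ i, (fib π i).Nonempty →
    (gmC H (fib π i) : ℝ) = m * (((fib π i).card : ℝ) - 1)
  obtain ⟨π, hπ, hmin⟩ := Finset.exists_min_image
    ((Finset.univ : Finset (V → Fin s)).filter valid)
    (fun π => (Finset.univ.image π).card) ⟨Fintype.equivFin V, by
      simp only [Finset.mem_filter, Finset.mem_univ, true_and]
      intro i hi
      have h1 : (fib (Fintype.equivFin V) i).card ≤ 1 := by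
        rw [Finset.card_le_one]
        intro a ha b hb
        simp only [fib, Finset.mem_filter, Finset.mem_univ, true_and] at ha hb
        exact (Fintype.equivFin V).injective (ha.trans hb.symm)
      have h2 := hi.card_pos
      have h3 : (fib (Fintype.equivFin V) i).card = 1 := by omega
      rw [gm_card_one H _ h1, h3]; simp⟩
  simp only [Finset.mem_filter, Finset.mem_univ, true_and] at hπ hmin
  refine ⟨π, ?_, ?_⟩
  · intro v hv
    by_contra hne
    have hxm : x ∈ fib π (π x) := by simp [fib]
    have hvm : v ∈ fib π (π x) := by simp [fib, hv]
    have h1 : 1 < (fib π (π x)).card := Finset.one_lt_card.2 ⟨v, hvm, x, hxm, hne⟩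
    exact absurd (hπ (π x) ⟨x, hxm⟩) (hx _ hxm h1).ne
  set Ec := (gmE H).filter (fun e => ¬ (e.map π).IsDiag) with hEc
  have hzero : ∀ I : Finset (Fin s),
      (I.filter (fun i => (fib π i).Nonempty)).card ≤ 1 →
      (Ec.filter (fun e => ∀ v ∈ e, π v ∈ I)).card = 0 := by
    intro I hI
    rw [Finset.card_eq_zero, Finset.filter_eq_empty_iff]
    intro e he h
    induction e using Sym2.ind with
    | _ u v =>
      rw [hEc, Finset.mem_filter] at he
      apply he.2
      rw [Sym2.map_mk, Sym2.mk_isDiag_iff]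
      refine Finset.card_le_one.1 hI _ ?_ _ ?_
      · rw [Finset.mem_filter]
        exact ⟨h u (by simp), u, by simp [fib]⟩
      · rw [Finset.mem_filter]
        exact ⟨h v (by simp), v, by simp [fib]⟩
  have hstrict : ∀ I : Finset (Fin s), 1 < I.card →
      ((Ec.filter (fun e => ∀ v ∈ e, π v ∈ I)).card : ℝ) < m * ((I.card : ℝ) - 1) := by
    intro I hI
    set I' := I.filter (fun i => (fib π i).Nonempty) with hI'
    have hII : I'.card ≤ I.card := Finset.card_filter_le _ _
    rcases Nat.lt_or_ge 1 I'.card with h | h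
    · set J : Finset V := Finset.univ.filter (fun v => π v ∈ I) with hJ
      obtain ⟨i0, hi0, i1, hi1, h01⟩ := Finset.one_lt_card.1 h
      have hi0I := (Finset.mem_filter.1 hi0).1
      have hi1I := (Finset.mem_filter.1 hi1).1
      obtain ⟨v0, hv0⟩ := (Finset.mem_filter.1 hi0).2
      obtain ⟨v1, hv1⟩ := (Finset.mem_filter.1 hi1).2
      simp only [fib, Finset.mem_filter, Finset.mem_univ, true_and] at hv0 hv1
      have hv0J : v0 ∈ J := by simp [hJ, hv0, hi0I]
      have hJlt : (gmC H J : ℝ) < m * ((J.card : ℝ) - 1) := by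
        refine lt_of_le_of_ne (gm_le_m1 H J ⟨v0, hv0J⟩) fun heq => ?_
        set π' : V → Fin s := fun v => if π v ∈ I then i0 else π v with hπ'
        have hval : valid π' := by
          intro i hi
          by_cases h2 : i = i0
          · have : fib π' i = J := by
              ext v
              simp only [fib, hJ, hπ', Finset.mem_filter, Finset.mem_univ, true_and, h2]
              split_ifs with h3
              · simp [h3]
              · simp only [h3, iff_false]
                intro h4; rw [h4] at h3; exact h3 hi0I
            rw [this]; exact heq
          · by_cases h3 : i ∈ I
            · obtain ⟨v, hv⟩ := hi
              simp only [fib, hπ', Finset.mem_filter, Finset.mem_univ, true_and] at hv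
              split_ifs at hv with h4
              · exact absurd hv.symm h2
              · rw [hv] at h4; exact absurd h3 h4
            · have : fib π' i = fib π i := by
                ext v
                simp only [fib, hπ', Finset.mem_filter, Finset.mem_univ, true_and]
                split_ifs with h4
                · constructor
                  · intro h5; exact absurd h5.symm h2
                  · intro h5; rw [h5] at h4; exact absurd h4 h3
                · rfl
              rw [this] at hi ⊢
              exact hπ i hi
        have hc := hmin π' hval
        have hlt : (Finset.univ.image π').card < (Finset.univ.image π).card := by
          refine Finset.card_lt_card ?_
          rw [Finset.ssubset_iff_of_subset]
          · refine ⟨i1, Finset.mem_image.2 ⟨v1, Finset.mem_univ _, hv1⟩, ?_⟩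
            rw [Finset.mem_image]
            rintro ⟨v, -, hv⟩
            simp only [hπ'] at hv
            split_ifs at hv with h4
            · exact h01 hv
            · rw [hv] at h4; exact h4 hi1I
          · intro i hi
            rw [Finset.mem_image] at hi ⊢
            obtain ⟨v, -, hv⟩ := hi
            simp only [hπ'] at hv
            split_ifs at hv with h4
            · exact ⟨v0, Finset.mem_univ _, hv0.trans hv⟩
            · exact ⟨v, Finset.mem_univ _, hv⟩
        omega
      -- partition count
      have hcardJ : J.card = ∑ i ∈ I', (fib π i).card := by
        rw [Finset.card_eq_sum_card_fiberwise (f := π) (t := I')]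
        · refine Finset.sum_congr rfl fun i hi => ?_
          congr 1
          ext v
          simp only [hJ, fib, Finset.mem_filter, Finset.mem_univ, true_and]
          constructor
          · rintro ⟨_, h⟩; exact h
          · intro h3; refine ⟨?_, h3⟩
            rw [h3]; exact (Finset.mem_filter.1 hi).1
        · intro v hv
          simp only [hJ, Finset.coe_filter, Finset.mem_univ, true_and, Set.mem_ofPred_eq] at hv
          rw [Finset.mem_coe, hI', Finset.mem_filter]
          exact ⟨hv, v, by simp [fib]⟩
      have hsplit : (Ec.filter (fun e => ∀ v ∈ e, π v ∈ I)).card + ∑ i ∈ I', gmC H (fib π i)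
          ≤ gmC H J := by
        unfold gmC
        rw [← Finset.card_biUnion, ← Finset.card_union_of_disjoint]
        · refine Finset.card_le_card ?_
          intro e he
          rw [Finset.mem_union] at he
          rcases he with he | he
          · rw [Finset.mem_filter, hEc, Finset.mem_filter] at he
            rw [Finset.mem_filter]
            refine ⟨he.1.1, fun v hv => ?_⟩
            simp [hJ, he.2 v hv]
          · rw [Finset.mem_biUnion] at he
            obtain ⟨i, hi, he⟩ := he
            rw [Finset.mem_filter] at he ⊢
            refine ⟨he.1, fun v hv => ?_⟩
            have h3 := he.2 v hv
            simp only [fib, Finset.mem_filter, Finset.mem_univ, true_and] at h3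
            simp only [hJ, Finset.mem_filter, Finset.mem_univ, true_and, h3]
            exact (Finset.mem_filter.1 hi).1
        · rw [Finset.disjoint_left]
          intro e he he'
          rw [Finset.mem_biUnion] at he'
          obtain ⟨i, hi, he'⟩ := he'
          rw [Finset.mem_filter] at he he'
          have h3 := (Finset.mem_filter.1 he.1).2
          apply h3
          induction e using Sym2.ind with
          | _ u v =>
            rw [Sym2.map_mk, Sym2.mk_isDiag_iff]
            have h4 := he'.2 u (by simp)
            have h5 := he'.2 v (by simp)
            simp only [fib, Finset.mem_filter, Finset.mem_univ, true_and] at h4 h5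
            rw [h4, h5]
        · intro i _ j _ hij
          rw [Function.onFun, Finset.disjoint_left]
          intro e he he'
          rw [Finset.mem_filter] at he he'
          induction e using Sym2.ind with
          | _ u v =>
            have h4 := he.2 u (by simp)
            have h5 := he'.2 u (by simp)
            simp only [fib, Finset.mem_filter, Finset.mem_univ, true_and] at h4 h5
            exact hij (h4.symm.trans h5)
      have hsumC : (∑ i ∈ I', (gmC H (fib π i) : ℝ)) = m * ((J.card : ℝ) - I'.card) := by
        rw [hcardJ]
        push_cast
        rw [mul_sub, Finset.mul_sum]
        have : m * (I'.card : ℝ) = ∑ i ∈ I', m := by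
          rw [Finset.sum_const, nsmul_eq_mul, mul_comm]
        rw [this, ← Finset.sum_sub_distrib]
        refine Finset.sum_congr rfl fun i hi => ?_
        rw [hπ i (Finset.mem_filter.1 hi).2]; ring
      have h6 : ((Ec.filter (fun e => ∀ v ∈ e, π v ∈ I)).card : ℝ) +
          ∑ i ∈ I', (gmC H (fib π i) : ℝ) ≤ gmC H J := by exact_mod_cast hsplit
      have h7 : (I'.card : ℝ) ≤ I.card := by exact_mod_cast hII
      rw [hsumC] at h6
      nlinarith
    · rw [hzero I h]
      have : (1 : ℝ) < I.card := by exact_mod_cast hI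
      push_cast
      have : 0 < (I.card : ℝ) - 1 := by linarith
      positivity
  have hev : ∀ᶠ m' in 𝓝[<] m, 0 < m' ∧ m' < m ∧ ∀ I : Finset (Fin s), 1 < I.card →
      ((Ec.filter (fun e => ∀ v ∈ e, π v ∈ I)).card : ℝ) < m' * ((I.card : ℝ) - 1) := by
    refine ((lt_mem_nhds hm0).filter_mono nhdsWithin_le_nhds).and
      (eventually_mem_nhdsWithin.and (Filter.eventually_all.2 fun I => ?_))
    by_cases hI : 1 < I.card
    · have hcont : Tendsto (fun m' : ℝ => m' * ((I.card : ℝ) - 1)) (𝓝[<] m)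
          (𝓝 (m * ((I.card : ℝ) - 1))) :=
        ((continuous_id.mul continuous_const).tendsto m).mono_left nhdsWithin_le_nhds
      filter_upwards [hcont.eventually (lt_mem_nhds (hstrict I hI))] with m' h _ using h
    · exact Filter.Eventually.of_forall fun _ h => absurd h hI
  obtain ⟨m', h1, h2, h3⟩ := hev.exists
  refine ⟨m', h1, h2, fun I hI => ?_⟩
  rcases Nat.lt_or_ge 1 I.card with h | h
  · exact (h3 I h).le
  · rw [hzero I ((Finset.card_filter_le _ _).trans h)]
    have := hI.card_pos
    have : I.card = 1 := by omega
    rw [this]; simp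

end gmD

open MeasureTheory Filter Topology
section gmE
open scoped Classical

instance gm_fin_bern (p : ℝ) : IsFiniteMeasure (bernoulliMeasure p) := by
  constructor
  unfold bernoulliMeasure
  simp only [Measure.coe_add, Measure.coe_smul, Pi.add_apply, Pi.smul_apply, smul_eq_mul,
    measure_univ, mul_one]
  refine ENNReal.add_lt_top.2 ⟨?_, ?_⟩
  · exact (min_le_right _ _).trans_lt ENNReal.one_lt_top
  · exact tsub_le_self.trans_lt ENNReal.one_lt_top

lemma gm_bern {p : ℝ} (h0 : 0 ≤ p) (h1 : p ≤ 1) (b : Bool) :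
    bernoulliMeasure p {b} = ENNReal.ofReal (if b then p else 1 - p) := by
  have hmin : min (ENNReal.ofReal p) 1 = ENNReal.ofReal p :=
    min_eq_left (by rw [← ENNReal.ofReal_one]; exact ENNReal.ofReal_le_ofReal h1)
  unfold bernoulliMeasure
  rw [hmin]
  cases b
  · simp [ENNReal.ofReal_sub 1 h0]
  · simp

lemma gm_gnp_singleton {n : ℕ} {p : ℝ} (h0 : 0 ≤ p) (h1 : p ≤ 1) (W : Finset (Sym2 (Fin n))) :
    gnp n p {fun e => decide (e ∈ W)} = ENNReal.ofReal (gmMu p W) := by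
  unfold gnp
  rw [Measure.pi_singleton]
  simp_rw [gm_bern h0 h1]
  rw [← ENNReal.ofReal_prod_of_nonneg]
  · congr 1
    simp only [decide_eq_true_eq]
    rw [Finset.prod_ite]
    simp only [Finset.prod_const, gmMu]
    congr 2
    · congr 1; ext; simp
    · rw [← Finset.card_compl]
      congr 1; ext; simp
  · intro e _
    split_ifs <;> linarith

lemma gm_gnp {n : ℕ} {p : ℝ} (h0 : 0 ≤ p) (h1 : p ≤ 1) (S : Set (Sym2 (Fin n) → Bool)) :
    gnp n p S = ENNReal.ofReal (gmEx p
      (fun W : Finset (Sym2 (Fin n)) => if (fun e => decide (e ∈ W)) ∈ S then 1 else 0)) := by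
  set T : Finset (Finset (Sym2 (Fin n))) :=
    Finset.univ.filter (fun W => (fun e => decide (e ∈ W)) ∈ S) with hT
  have hinj : Function.Injective
      (fun (W : Finset (Sym2 (Fin n))) (e : Sym2 (Fin n)) => decide (e ∈ W)) := by
    intro W W' h
    ext e
    have := congrFun h e
    simpa using this
  have hS : S = ((T.image (fun W e => decide (e ∈ W)) : Finset (Sym2 (Fin n) → Bool)) :
      Set (Sym2 (Fin n) → Bool)) := by
    ext ω
    simp only [hT, Finset.coe_image, Set.mem_image, Finset.coe_filter, Finset.mem_univ, true_and,
      Set.mem_ofPred_eq]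
    constructor
    · intro h
      have e : (fun e => decide (e ∈ Finset.univ.filter (fun e => ω e = true))) = ω := by
        funext e; simp
      exact ⟨Finset.univ.filter (fun e => ω e = true), by rw [e]; exact h, e⟩
    · rintro ⟨W, h, rfl⟩
      exact h
  conv_lhs => rw [hS]
  rw [← MeasureTheory.sum_measure_singleton, Finset.sum_image hinj.injOn]
  simp_rw [gm_gnp_singleton h0 h1]
  rw [← ENNReal.ofReal_sum_of_nonneg (fun W _ => gmMu_nonneg h0 h1 W)]
  congr 1
  unfold gmEx
  rw [hT, Finset.sum_filter]
  simp

/-- `W` contains `N` disjoint copies of `H - x`, with extra vertices for `x`. -/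
def gmGood {V : Type*} (H : SimpleGraph V) (x : V) (N n : ℕ) (W : Finset (Sym2 (Fin n)))
    (f : Fin N × V → Fin n) : Prop :=
  Function.Injective f ∧ ∀ k u v, H.Adj u v → u ≠ x → v ≠ x → s(f (k, u), f (k, v)) ∈ W

lemma gm_extend {V : Type*} [Fintype V] (x : V) (N n : ℕ) (hN : N * Fintype.card V ≤ n)
    (g : Fin N × {v : V // v ≠ x} → Fin n) (hg : Function.Injective g) :
    ∃ f : Fin N × V → Fin n, Function.Injective f ∧ ∀ k (v : {v : V // v ≠ x}),
      f (k, v.1) = g (k, v) := by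
  have hV : 0 < Fintype.card V := Fintype.card_pos_iff.2 ⟨x⟩
  have hc : Fintype.card {v : V // v ≠ x} = Fintype.card V - 1 := by
    simp
  have hcard : N ≤ ((Finset.univ.image g)ᶜ).card := by
    rw [Finset.card_compl, Finset.card_image_of_injective _ hg, Finset.card_univ,
      Fintype.card_prod, hc, Fintype.card_fin, Fintype.card_fin, Nat.mul_sub, mul_one]
    have : N ≤ N * Fintype.card V := Nat.le_mul_of_pos_right _ hV
    omega
  obtain ⟨h⟩ : Nonempty (Fin N ↪ ((Finset.univ.image g)ᶜ : Finset (Fin n))) := by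
    rw [Function.Embedding.nonempty_iff_card_le]
    rw [Fintype.card_fin, Fintype.card_coe]
    exact hcard
  have hh : ∀ k z, (h k : Fin n) ≠ g z := by
    intro k z heq
    have := (h k).2
    rw [Finset.mem_compl, Finset.mem_image] at this
    exact this ⟨z, Finset.mem_univ _, heq.symm⟩
  refine ⟨fun z => if hz : z.2 ≠ x then g (z.1, ⟨z.2, hz⟩) else h z.1, ?_, ?_⟩
  · rintro ⟨k, v⟩ ⟨k', v'⟩ heq
    simp only at heq
    split_ifs at heq with h1 h2 h2
    · have := hg heq
      simp only [Prod.mk.injEq, Subtype.mk.injEq] at this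
      rw [this.1, this.2]
    · exact absurd heq.symm (hh _ _)
    · exact absurd heq (hh _ _)
    · have := h.injective (Subtype.ext heq)
      push Not at h1 h2
      rw [h1, h2, this]
  · intro k v
    simp only
    rw [dif_pos v.2]

lemma gm_stage1 {V : Type*} [Fintype V] (H : SimpleGraph V) (hE : H.edgeSet.Nonempty) (x : V)
    (N M n : ℕ) (q t : ℝ) (hq : 0 < q) (hq1 : q ≤ 1) (hM : Real.exp 1 ≤ M)
    (hMn : M * (Fintype.card V - 1) ≤ n) (hN : N * Fintype.card V ≤ n) (ht : (N : ℝ) + t ≤ M) :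
    gmEx q (fun W : Finset (Sym2 (Fin n)) => if ∃ f, gmGood H x N n W f then 0 else 1) ≤
      Real.exp (-t) * Real.exp (((M * (Fintype.card V) ^ 2 : ℕ) : ℝ) *
        (Real.exp 1 / (((M : ℝ) / Real.exp 1) ^ (1 / m1 H) * q))) := by
  obtain ⟨hm1, -⟩ := gm_m1_attained H hE
  have hm0 : 0 < m1 H := by linarith
  have hMpos : (0 : ℝ) < M := (Real.exp_pos 1).trans_le hM
  set V' := {v : V // v ≠ x} with hV'
  have hc : Fintype.card V' = Fintype.card V - 1 := by
    simp [hV']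
  set H' : SimpleGraph V' := H.comap Subtype.val with hH'
  set π : V' → Fin (Fintype.card V') := fun v => Fintype.equivFin V' v with hπ
  obtain ⟨⟨f, hf⟩⟩ : Nonempty (Fin M × V' ↪ Fin n) := by
    rw [Function.Embedding.nonempty_iff_card_le, Fintype.card_prod, hc]
    simpa using hMn
  have hdens : ∀ I : Finset (Fin (Fintype.card V')), I.Nonempty →
      (((gmE H').filter (fun e => ∀ v ∈ e, π v ∈ I)).card : ℝ) ≤ m1 H * ((I.card : ℝ) - 1) := by
    intro I hI
    set J : Finset V := I.image (fun i => ((Fintype.equivFin V').symm i).1) with hJ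
    have hJI : J.card ≤ I.card := Finset.card_image_le
    have h1 : ((gmE H').filter (fun e => ∀ v ∈ e, π v ∈ I)).card ≤ gmC H J := by
      unfold gmC
      refine Finset.card_le_card_of_injOn (Sym2.map Subtype.val) ?_
        (Sym2.map.injective Subtype.val_injective).injOn
      intro e he
      induction e using Sym2.ind with
      | _ u v =>
        simp only [Finset.coe_filter, gmE, Finset.mem_filter, Finset.mem_univ, true_and,
          Set.mem_ofPred_eq, SimpleGraph.mem_edgeSet, hH', SimpleGraph.comap_adj,
          Sym2.mem_iff, Sym2.map_mk] at he ⊢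
        refine ⟨he.1, ?_⟩
        rintro w (rfl | rfl)
        · exact Finset.mem_image.2 ⟨π u, he.2 u (Or.inl rfl), by simp [hπ]⟩
        · exact Finset.mem_image.2 ⟨π v, he.2 v (Or.inr rfl), by simp [hπ]⟩
    have h2 := gm_le_m1 H J (hI.image _)
    have h3 : (((gmE H').filter (fun e => ∀ v ∈ e, π v ∈ I)).card : ℝ) ≤ gmC H J := by
      exact_mod_cast h1
    have h4 : (J.card : ℝ) ≤ I.card := by exact_mod_cast hJI
    nlinarith
  have hsp := gm_spread π (m1 H) hm0 (gmE H') hM (fun I hI => by convert hdens I hI) f hf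
  have hEc : (gmE H').card ≤ (Fintype.card V) ^ 2 := by
    have h1 : (gmE H').card ≤ ((Finset.univ : Finset (V × V)).image (fun z => s(z.1, z.2))).card := by
      refine Finset.card_le_card_of_injOn (Sym2.map Subtype.val) ?_
        (Sym2.map.injective Subtype.val_injective).injOn
      intro e _
      induction e using Sym2.ind with
      | _ u v =>
        rw [Finset.mem_coe, Finset.mem_image]
        exact ⟨(u.1, v.1), Finset.mem_univ _, rfl⟩
    refine h1.trans (Finset.card_image_le.trans ?_)
    rw [Finset.card_univ, Fintype.card_prod, sq]
  have h1r := gm_one_round (Finset.univ : Finset (Fin (Fintype.card V') → Equiv.Perm (Fin M)))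
    Finset.univ_nonempty (gmS π (gmE H') f) (((M : ℝ) / Real.exp 1) ^ (1 / m1 H)) q
    (Real.exp 1) t ((M * (Fintype.card V) ^ 2 : ℕ) : ℝ) (by positivity) hq hq1
    (Real.one_le_exp (by norm_num)) (by positivity) (fun A => hsp A) (fun σ _ => by
      exact_mod_cast (gmS_card π (gmE H') f σ).trans (Nat.mul_le_mul_left _ hEc))
  rw [Real.exp_one_rpow] at h1r
  refine le_trans (gmEx_mono hq.le hq1 fun W => ?_) h1r
  by_cases hex : ∃ σ ∈ (Finset.univ : Finset (Fin (Fintype.card V') → Equiv.Perm (Fin M))),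
      ((gmS π (gmE H') f σ \ W).card : ℝ) < t
  · rw [if_pos hex, if_pos]
    obtain ⟨σ, -, hσ⟩ := hex
    set im : Fin M → Sym2 V' → Sym2 (Fin n) := fun k e => e.map (fun v => f (σ (π v) k, v)) with him
    set K : Finset (Fin M) := Finset.univ.filter (fun k => ∀ e ∈ gmE H', im k e ∈ W) with hK
    have hKc : Kᶜ.card ≤ (gmS π (gmE H') f σ \ W).card := by
      obtain ⟨v0, hv0⟩ : ∃ v : V, v ≠ x := by
        obtain ⟨e, he⟩ := hE
        induction e using Sym2.ind with
        | _ u v =>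
          have huv : u ≠ v := SimpleGraph.Adj.ne he
          by_cases hu : u = x
          · exact ⟨v, fun hv => huv (hu.trans hv.symm)⟩
          · exact ⟨u, hu⟩
      have hex : ∀ k : Fin M, ∃ e : Sym2 (Fin n), k ∈ Kᶜ →
          ∃ e' ∈ gmE H', e = im k e' ∧ e ∉ W := by
        intro k
        by_cases hk : k ∈ K
        · refine ⟨s((f (k, ⟨v0, hv0⟩)), (f (k, ⟨v0, hv0⟩))), fun h => ?_⟩
          rw [Finset.mem_compl] at h
          exact absurd hk h
        · simp only [hK, Finset.mem_filter, Finset.mem_univ, true_and] at hk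
          push Not at hk
          obtain ⟨e, h1, h2⟩ := hk
          exact ⟨im k e, fun _ => ⟨e, h1, rfl, h2⟩⟩
      choose g hg using hex
      refine Finset.card_le_card_of_injOn g ?_ ?_
      · intro k hk
        obtain ⟨e', h1, h2, h3⟩ := hg k hk
        rw [Finset.mem_coe, Finset.mem_sdiff]
        refine ⟨?_, h3⟩
        rw [gmS, Finset.mem_image]
        exact ⟨(k, e'), by simp [h1], h2.symm⟩
      · intro k hk k' hk' heq
        obtain ⟨e, h1, h2, h3⟩ := hg k hk
        obtain ⟨e', h1', h2', h3'⟩ := hg k' hk'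
        rw [h2, h2'] at heq
        induction e using Sym2.ind with
        | _ u v =>
          have hmem : f (σ (π u) k, u) ∈ im k' e' := by
            rw [← heq]
            simp [him]
          rw [him, Sym2.mem_map] at hmem
          obtain ⟨w, _, hw⟩ := hmem
          have := hf hw
          simp only [Prod.mk.injEq] at this
          obtain ⟨h4, rfl⟩ := this
          exact ((σ (π w)).injective h4).symm
    have hKN : N ≤ K.card := by
      have h1 : K.card + Kᶜ.card = M := by
        rw [Finset.card_add_card_compl, Fintype.card_fin]
      have h2 : (Kᶜ.card : ℝ) < t := lt_of_le_of_lt (by exact_mod_cast hKc) hσ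
      have h3 : (K.card : ℝ) + Kᶜ.card = M := by exact_mod_cast h1
      have h4 : (N : ℝ) ≤ K.card := by linarith
      exact_mod_cast h4
    obtain ⟨h⟩ : Nonempty (Fin N ↪ K) := by
      rw [Function.Embedding.nonempty_iff_card_le]
      rw [Fintype.card_fin, Fintype.card_coe]
      exact hKN
    obtain ⟨f1, hf1, hf1'⟩ := gm_extend x N n hN
      (fun z : Fin N × V' => f (σ (π z.2) (h z.1), z.2)) (by
        rintro ⟨k, v⟩ ⟨k', v'⟩ heq
        have h1 := hf heq
        simp only [Prod.mk.injEq] at h1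
        obtain ⟨h2, rfl⟩ := h1
        have h3 := h.injective (Subtype.ext ((σ (π v)).injective h2))
        rw [h3])
    refine ⟨f1, hf1, ?_⟩
    intro k u v huv hu hv
    rw [hf1' k ⟨u, hu⟩, hf1' k ⟨v, hv⟩]
    have h2 := (h k).2
    simp only [hK, Finset.mem_filter, Finset.mem_univ, true_and] at h2
    have h3 := h2 s(⟨u, hu⟩, ⟨v, hv⟩) (by
      simp only [gmE, Finset.mem_filter, Finset.mem_univ, true_and, SimpleGraph.mem_edgeSet, hH',
        SimpleGraph.comap_adj]
      exact huv)
    simpa [him] using h3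
  · rw [if_neg hex]
    split_ifs <;> norm_num

end gmE

open MeasureTheory Filter Topology
section gmF
open scoped Classical

/-- the edge set `W` contains an `H`-factor -/
def gmFac {V : Type*} [Fintype V] (H : SimpleGraph V) (n : ℕ) (W : Finset (Sym2 (Fin n))) : Prop :=
  ∃ f : Fin (n / Fintype.card V) × V → Fin n, Function.Injective f ∧
    ∀ i u v, H.Adj u v → s(f (i, u), f (i, v)) ∈ W

lemma gmFac_mono {V : Type*} [Fintype V] (H : SimpleGraph V) (n : ℕ)
    {W W' : Finset (Sym2 (Fin n))} (h : W ⊆ W') (hW : gmFac H n W) : gmFac H n W' := by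
  obtain ⟨f, h1, h2⟩ := hW
  exact ⟨f, h1, fun i u v huv => h (h2 i u v huv)⟩

lemma gmFac_iff {V : Type*} [Fintype V] (H : SimpleGraph V) (n : ℕ) (W : Finset (Sym2 (Fin n))) :
    HasFactor H (graphOf (fun e => decide (e ∈ W))) ↔ gmFac H n W := by
  unfold HasFactor gmFac graphOf
  refine exists_congr fun f => and_congr_right fun hf => ?_
  refine forall_congr' fun i => forall_congr' fun u => forall_congr' fun v => ?_
  refine imp_congr_right fun huv => ?_
  rw [SimpleGraph.fromRel_adj]
  simp only [decide_eq_true_eq]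
  rw [Sym2.eq_swap (a := f (i, v)), or_self]
  constructor
  · exact fun h => h.2
  · refine fun h => ⟨fun heq => ?_, h⟩
    have := hf heq
    simp only [Prod.mk.injEq, true_and] at this
    exact huv.ne this

lemma gm_combine {V : Type*} [Fintype V] (H : SimpleGraph V) (x : V)
    (π : V → Fin (Fintype.card V)) (hπ : ∀ v, π v = π x → v = x) (m' : ℝ) (hm' : 0 < m')
    (hd : ∀ I : Finset (Fin (Fintype.card V)), I.Nonempty →
        ((((gmE H).filter (fun e => ¬ (e.map π).IsDiag)).filter
          (fun e => ∀ v ∈ e, π v ∈ I)).card : ℝ) ≤ m' * ((I.card : ℝ) - 1))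
    (n : ℕ) (hN : Real.exp 1 ≤ ((n / Fintype.card V : ℕ) : ℝ))
    (q1 q Y F : ℝ) (h0 : 0 ≤ q1) (h1 : q1 ≤ 1) (hq : 0 < q) (hq1 : q ≤ 1) (hY : Real.exp 1 ≤ Y)
    (hL : Y ^ 2 ≤ (((n / Fintype.card V : ℕ) : ℝ) / Real.exp 1) ^ (1 / m') * q) (J : ℕ)
    (hJ : (((n / Fintype.card V) * (gmE H).card + 1 : ℕ) : ℝ) ≤ Y ^ J)
    (hF : gmEx q1 (fun W : Finset (Sym2 (Fin n)) =>
      if ∃ f, gmGood H x (n / Fintype.card V) n W f then 0 else 1) ≤ F) :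
    gmEx (q1 + (1 - (1 - q) ^ J) - q1 * (1 - (1 - q) ^ J))
      (fun W : Finset (Sym2 (Fin n)) => if gmFac H n W then 0 else 1) ≤
      F + J * (Real.exp 1 / Y) := by
  set N := n / Fintype.card V with hNdef
  set Ec := (gmE H).filter (fun e => ¬ (e.map π).IsDiag) with hEc
  have hNpos : (0 : ℝ) < N := (Real.exp_pos 1).trans_le hN
  have hp0 : 0 ≤ (1 - q) ^ J := pow_nonneg (by linarith) _
  have hp1 : (1 - q) ^ J ≤ 1 := pow_le_one₀ (by linarith) (by linarith)
  have hY0 : 0 < Y := (Real.exp_pos 1).trans_le hY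
  rw [← gmEx_or]
  have key : gmEx q1 (fun W1 : Finset (Sym2 (Fin n)) => gmEx (1 - (1 - q) ^ J)
      (fun W2 => if gmFac H n (W1 ∪ W2) then (0 : ℝ) else 1)) ≤
      gmEx q1 (fun W : Finset (Sym2 (Fin n)) =>
      (if ∃ f, gmGood H x N n W f then 0 else 1) + J * (Real.exp 1 / Y)) := by
    refine gmEx_mono h0 h1 fun W1 => ?_
    by_cases hg : ∃ f, gmGood H x N n W1 f
    · rw [if_pos hg, zero_add]
      obtain ⟨f, hf, hfW⟩ := hg
      have hit := gm_iter' (Finset.univ : Finset (Fin (Fintype.card V) → Equiv.Perm (Fin N)))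
        Finset.univ_nonempty (gmS π Ec f) (((N : ℝ) / Real.exp 1) ^ (1 / m')) q Y
        (by positivity) hq hq1 hY hL J ((N * (gmE H).card + 1 : ℕ) : ℝ)
        (fun A => gm_spread π m' hm' Ec hN hd f hf A)
        (fun σ _ => by
          have h2 := gmS_card π Ec f σ
          have h3 : Ec.card ≤ (gmE H).card := Finset.card_filter_le _ _
          have h4 : N * Ec.card ≤ N * (gmE H).card := Nat.mul_le_mul_left _ h3
          exact_mod_cast Nat.lt_succ_of_le (h2.trans h4)) (by positivity) hJ
      refine le_trans (gmEx_mono (by linarith) (by linarith) fun W2 => ?_) hit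
      by_cases hex : ∃ σ ∈ (Finset.univ : Finset (Fin (Fintype.card V) → Equiv.Perm (Fin N))),
          gmS π Ec f σ ⊆ W2
      · rw [if_pos hex, if_pos]
        obtain ⟨σ, -, hσ⟩ := hex
        refine ⟨fun z => f (σ (π z.2) z.1, z.2), ?_, ?_⟩
        · rintro ⟨k, v⟩ ⟨k', v'⟩ heq
          have h1 := hf heq
          simp only [Prod.mk.injEq] at h1
          obtain ⟨h2, rfl⟩ := h1
          rw [(σ (π v)).injective h2]
        · intro k u v huv
          rw [Finset.mem_union]
          by_cases hpv : π u = π v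
          · left
            simp only
            rw [← hpv]
            refine hfW _ u v huv ?_ ?_
            · rintro rfl
              exact huv.ne (hπ v hpv.symm).symm
            · rintro rfl
              exact huv.ne (hπ u hpv)
          · right
            refine hσ ?_
            rw [gmS, Finset.mem_image]
            refine ⟨(k, s(u, v)), ?_, rfl⟩
            simp [hEc, gmE, huv, hpv]
      · rw [if_neg hex]
        split_ifs <;> norm_num
    · rw [if_neg hg]
      have h2 : gmEx (1 - (1 - q) ^ J)
          (fun W2 => if gmFac H n (W1 ∪ W2) then (0 : ℝ) else 1) ≤
          gmEx (1 - (1 - q) ^ J) (fun _ : Finset (Sym2 (Fin n)) => (1 : ℝ)) :=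
        gmEx_mono (by linarith) (by linarith) fun W2 => by split_ifs <;> norm_num
      rw [gmEx_const] at h2
      have : 0 ≤ J * (Real.exp 1 / Y) := by positivity
      linarith
  refine key.trans ?_
  rw [gmEx_add, gmEx_const]
  linarith

end gmF

open MeasureTheory Filter Topology
section gmG
open scoped Classical

lemma gmFac_nonneg {V : Type*} [Fintype V] (H : SimpleGraph V) (n : ℕ) {p : ℝ} (h0 : 0 ≤ p)
    (h1 : p ≤ 1) :
    0 ≤ gmEx p (fun W : Finset (Sym2 (Fin n)) => if gmFac H n W then (0 : ℝ) else 1) := by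
  have h := gmEx_mono (X := Sym2 (Fin n)) h0 h1 (f := fun _ => 0)
    (g := fun W => if gmFac H n W then (0 : ℝ) else 1) (fun W => by
      split_ifs <;> norm_num)
  rwa [gmEx_const] at h

set_option maxHeartbeats 2000000 in
lemma gm_upper_bound {V : Type*} [Fintype V] (H : SimpleGraph V) (hE : H.edgeSet.Nonempty)
    (x : V) (π : V → Fin (Fintype.card V)) (hπ : ∀ v, π v = π x → v = x) (m' : ℝ) (hm' : 0 < m')
    (hd : ∀ I : Finset (Fin (Fintype.card V)), I.Nonempty →
        ((((gmE H).filter (fun e => ¬ (e.map π).IsDiag)).filter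
          (fun e => ∀ v ∈ e, π v ∈ I)).card : ℝ) ≤ m' * ((I.card : ℝ) - 1))
    (hv2 : 2 ≤ Fintype.card V)
    (n : ℕ) (p a b c ε Y : ℝ) (J : ℕ) (ha : a = 1 / m1 H) (hb : b = 1 / m') (ha0 : 0 < a)
    (hb0 : 0 < b)
    (hc : c = 1 / (6 * Fintype.card V)) (hε : ε = 1 / (2 * Fintype.card V * (Fintype.card V - 1)))
    (hp0 : 0 < p) (hp1 : p ≤ 1) (hJ : 0 < J)
    (hn1 : 2 * (Fintype.card V : ℝ) * (Fintype.card V - 1) ≤ n)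
    (hn2 : 6 * (Fintype.card V : ℝ) ≤ n)
    (hY : Y = (n : ℝ) ^ ((b - a) / 2))
    (hYe : Real.exp 1 ≤ Y)
    (hK1 : 12 * (Fintype.card V : ℝ) ^ 2 / (c ^ a * ε) ≤ p * (n : ℝ) ^ a)
    (hK2 : 2 * J / c ^ b ≤ p * (n : ℝ) ^ a)
    (hYJ : (((n / Fintype.card V) * (gmE H).card + 1 : ℕ) : ℝ) ≤ Y ^ J) :
    gmEx p (fun W : Finset (Sym2 (Fin n)) => if gmFac H n W then (0 : ℝ) else 1) ≤
      Real.exp (-(ε * n / 2)) + J * (Real.exp 1 / Y) := by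
  have hcomb0 := gm_combine H x π hπ m' hm' hd n
  clear hd hπ π
  set v := Fintype.card V with hv
  have hvr : (2 : ℝ) ≤ v := by exact_mod_cast hv2
  have he : Real.exp 1 < 3 := by linarith [Real.exp_one_lt_d9]
  have he0 := Real.exp_pos 1
  have hnpos : (0 : ℝ) < n := by linarith
  have hc0 : 0 < c := by rw [hc]; positivity
  have hv1 : (0 : ℝ) < v - 1 := by linarith
  have hε0 : 0 < ε := by rw [hε]; positivity
  set N := n / v with hN
  set M := n / (v - 1) with hM
  have hNle : (N : ℝ) ≤ n / v := Nat.cast_div_le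
  have hMle : (M : ℝ) ≤ n / (v - 1) := by
    have := Nat.cast_div_le (α := ℝ) (m := n) (n := v - 1)
    rwa [Nat.cast_sub (by omega), Nat.cast_one] at this
  have hNlo : (n : ℝ) / v - 1 ≤ N := by
    have h1 := Nat.lt_div_mul_add (a := n) (b := v) (by omega)
    have h2 : (n : ℝ) < N * v + v := by exact_mod_cast h1
    rw [sub_le_iff_le_add, div_le_iff₀ (by linarith)]
    nlinarith
  have hMlo : (n : ℝ) / (v - 1) - 1 ≤ M := by
    have h1 := Nat.lt_div_mul_add (a := n) (b := v - 1) (by omega)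
    have h2 : (n : ℝ) < M * (v - 1 : ℕ) + (v - 1 : ℕ) := by exact_mod_cast h1
    rw [Nat.cast_sub (by omega), Nat.cast_one] at h2
    rw [sub_le_iff_le_add, div_le_iff₀ hv1]
    nlinarith
  have hN2 : c * n * 3 ≤ N := by
    refine le_trans ?_ hNlo
    have h1 : (6 : ℝ) ≤ n / v := by rw [le_div_iff₀ (by linarith)]; exact hn2
    have h2 : c * n * 3 = (n / v) / 2 := by rw [hc]; field_simp; norm_num
    linarith
  have hN3 : (3 : ℝ) ≤ N := by
    have h1 : (6 : ℝ) ≤ n / v := by rw [le_div_iff₀ (by linarith)]; exact hn2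
    linarith
  have hNM : (N : ℝ) + ε * n ≤ M := by
    have h1 : (n : ℝ) / (v - 1) - n / v = 2 * (ε * n) := by rw [hε]; field_simp; ring
    have h2 : 1 ≤ ε * n := by
      rw [hε, div_mul_eq_mul_div, one_mul, le_div_iff₀ (by positivity), one_mul]; exact hn1
    linarith
  have hMN : (N : ℝ) ≤ M := by nlinarith
  have hbase : ∀ z : ℝ, (N : ℝ) ≤ z → c * n ≤ z / Real.exp 1 := by
    intro z hz
    rw [le_div_iff₀ he0]
    have : c * n * Real.exp 1 ≤ c * n * 3 := by gcongr
    linarith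
  have hna : 0 < (n : ℝ) ^ a := Real.rpow_pos_of_pos hnpos _
  have hca : 0 < c ^ a := Real.rpow_pos_of_pos hc0 _
  have hcb : 0 < c ^ b := Real.rpow_pos_of_pos hc0 _
  have hJr : (1 : ℝ) ≤ J := by exact_mod_cast hJ
  have hκ1 : c ^ a * (n : ℝ) ^ a ≤ ((M : ℝ) / Real.exp 1) ^ a := by
    rw [← Real.mul_rpow hc0.le hnpos.le]
    exact Real.rpow_le_rpow (by positivity) (hbase M hMN) ha0.le
  have hκ2 : c ^ b * (n : ℝ) ^ b ≤ ((N : ℝ) / Real.exp 1) ^ b := by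
    rw [← Real.mul_rpow hc0.le hnpos.le]
    exact Real.rpow_le_rpow (by positivity) (hbase N le_rfl) hb0.le
  have hst1 := gm_stage1 H hE x N M n (p / 2) (ε * n) (by linarith) (by linarith)
    (by linarith) (Nat.div_mul_le_self n (v - 1)) (Nat.div_mul_le_self n v) hNM
  have hF : gmEx (p / 2) (fun W : Finset (Sym2 (Fin n)) =>
      if ∃ f, gmGood H x N n W f then (0 : ℝ) else 1) ≤ Real.exp (-(ε * n / 2)) := by
    refine hst1.trans ?_
    rw [← Real.exp_add, Real.exp_le_exp, ← ha, ← hv]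
    have h1 : c ^ a * (p * (n : ℝ) ^ a) / 2 ≤ ((M : ℝ) / Real.exp 1) ^ a * (p / 2) := by
      calc _ = c ^ a * (n : ℝ) ^ a * (p / 2) := by ring
        _ ≤ _ := by gcongr
    have h2 : 6 * (v : ℝ) ^ 2 / ε ≤ ((M : ℝ) / Real.exp 1) ^ a * (p / 2) := by
      refine le_trans ?_ h1
      have h3 : c ^ a * (12 * (v : ℝ) ^ 2 / (c ^ a * ε)) / 2 ≤ c ^ a * (p * (n : ℝ) ^ a) / 2 := by
        gcongr
      refine le_trans (le_of_eq ?_) h3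
      field_simp
      norm_num
    have h3 : Real.exp 1 / (((M : ℝ) / Real.exp 1) ^ a * (p / 2)) ≤ 3 / (6 * (v : ℝ) ^ 2 / ε) := by
      gcongr
    have hMn : (M : ℝ) ≤ n := by exact_mod_cast Nat.div_le_self n (v - 1)
    have h4 : ((M * v ^ 2 : ℕ) : ℝ) * (Real.exp 1 / (((M : ℝ) / Real.exp 1) ^ a * (p / 2))) ≤
        (n * (v : ℝ) ^ 2) * (3 / (6 * (v : ℝ) ^ 2 / ε)) := by
      push_cast
      gcongr
    have h5 : (n * (v : ℝ) ^ 2) * (3 / (6 * (v : ℝ) ^ 2 / ε)) = ε * n / 2 := by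
      field_simp
      norm_num
    linarith
  have hq0 : 0 < p / (2 * J) := by positivity
  have hq1 : p / (2 * J) ≤ 1 := by
    rw [div_le_iff₀ (by positivity)]
    linarith
  have hL : Y ^ 2 ≤ ((N : ℝ) / Real.exp 1) ^ (1 / m') * (p / (2 * J)) := by
    rw [← hb]
    have h1 : Y ^ 2 = (n : ℝ) ^ (b - a) := by
      rw [hY, ← Real.rpow_natCast, ← Real.rpow_mul hnpos.le]
      congr 1
      push_cast; ring
    have h2 : (n : ℝ) ^ b = (n : ℝ) ^ (b - a) * (n : ℝ) ^ a := by
      rw [← Real.rpow_add hnpos]; congr 1; ring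
    have h3 : 0 < (n : ℝ) ^ (b - a) := Real.rpow_pos_of_pos hnpos _
    rw [h1]
    calc (n : ℝ) ^ (b - a) = (n : ℝ) ^ (b - a) * (c ^ b / (2 * J) * (2 * J / c ^ b)) := by
          field_simp
      _ ≤ (n : ℝ) ^ (b - a) * (c ^ b / (2 * J) * (p * (n : ℝ) ^ a)) := by gcongr
      _ = c ^ b * (n : ℝ) ^ b * (p / (2 * J)) := by rw [h2]; ring
      _ ≤ _ := by gcongr
  have hcomb := hcomb0 (by linarith) (p / 2) (p / (2 * J)) Y
    (Real.exp (-(ε * n / 2))) (by linarith) (by linarith) hq0 hq1 hYe hL J hYJ hF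
  refine le_trans ?_ hcomb
  have hp0' : 0 ≤ (1 - p / (2 * J)) ^ J := pow_nonneg (by linarith) _
  have hp1' : (1 - p / (2 * J)) ^ J ≤ 1 := pow_le_one₀ (by linarith) (by linarith)
  have hbern : 1 - p / 2 ≤ (1 - p / (2 * J)) ^ J := by
    have h1 := one_add_mul_le_pow (a := -(p / (2 * J))) (by linarith) J
    have h2 : (J : ℝ) * -(p / (2 * J)) = -(p / 2) := by field_simp
    rw [h2] at h1
    simpa [sub_eq_add_neg] using h1
  refine gmEx_anti ?_ ?_ hp1 _ ?_
  · nlinarith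
  · nlinarith
  · intro A B hAB
    by_cases hA : gmFac H n A
    · rw [if_pos hA, if_pos (gmFac_mono H n hAB hA)]
    · rw [if_neg hA]
      split_ifs <;> norm_num

lemma gm_upper {V : Type*} [Fintype V] (H : SimpleGraph V) (hE : H.edgeSet.Nonempty)
    (hnb : ¬ VertexOneBalanced H) (p : ℕ → ℝ) (hp : ∀ n, 0 ≤ p n ∧ p n ≤ 1)
    (hlim : Tendsto (fun n : ℕ => p n * (n : ℝ) ^ (1 / m1 H)) atTop atTop) :
    Tendsto (fun n : ℕ => gmEx (p n)
      (fun W : Finset (Sym2 (Fin n)) => if gmFac H n W then (0 : ℝ) else 1)) atTop (𝓝 0) := by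
  obtain ⟨x, hx⟩ := gm_exists_loose H hE hnb
  obtain ⟨π, hπ, m', hm', hmm, hd⟩ := gm_partition H hE x hx
  obtain ⟨hm1, -⟩ := gm_m1_attained H hE
  have hv2 : 2 ≤ Fintype.card V := by
    obtain ⟨e, he⟩ := hE
    induction e using Sym2.ind with
    | _ u v =>
      have huv : u ≠ v := SimpleGraph.Adj.ne he
      have := Finset.card_le_univ ({u, v} : Finset V)
      rwa [Finset.card_pair huv] at this
  obtain ⟨a, ha⟩ : ∃ a, a = 1 / m1 H := ⟨_, rfl⟩
  obtain ⟨b, hb⟩ : ∃ b, b = 1 / m' := ⟨_, rfl⟩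
  have ha0 : 0 < a := by rw [ha]; positivity
  have hb0 : 0 < b := by rw [hb]; positivity
  have hab : a < b := by rw [ha, hb]; exact one_div_lt_one_div_of_lt hm' hmm
  obtain ⟨c, hc⟩ : ∃ c : ℝ, c = 1 / (6 * Fintype.card V) := ⟨_, rfl⟩
  obtain ⟨ε, hε⟩ : ∃ ε : ℝ, ε = 1 / (2 * Fintype.card V * (Fintype.card V - 1)) := ⟨_, rfl⟩
  have hε0 : 0 < ε := by
    have : (2 : ℝ) ≤ Fintype.card V := by exact_mod_cast hv2
    rw [hε]
    have : (0 : ℝ) < Fintype.card V - 1 := by linarith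
    positivity
  obtain ⟨J, hJ⟩ : ∃ J : ℕ, J = ⌈4 / (b - a)⌉₊ + 1 := ⟨_, rfl⟩
  have hJ4 : 2 ≤ (b - a) / 2 * J := by
    have h1 : 4 / (b - a) ≤ J := by
      rw [hJ]; push_cast
      linarith [Nat.le_ceil (4 / (b - a))]
    rw [div_le_iff₀ (by linarith)] at h1
    linarith
  have hnt : Tendsto (fun n : ℕ => (n : ℝ)) atTop atTop := tendsto_natCast_atTop_atTop
  have hYt : Tendsto (fun n : ℕ => (n : ℝ) ^ ((b - a) / 2)) atTop atTop :=
    (tendsto_rpow_atTop (by linarith)).comp hnt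
  rw [← ha] at hlim
  have hlimit : Tendsto (fun n : ℕ => Real.exp (-(ε * n / 2)) +
      J * (Real.exp 1 / (n : ℝ) ^ ((b - a) / 2))) atTop (𝓝 0) := by
    have h1 : Tendsto (fun n : ℕ => Real.exp (-(ε * n / 2))) atTop (𝓝 0) := by
      refine Real.tendsto_exp_neg_atTop_nhds_zero.comp ?_
      have : Tendsto (fun n : ℕ => (ε / 2) * (n : ℝ)) atTop atTop :=
        hnt.const_mul_atTop (by positivity)
      refine this.congr fun n => by ring
    have h2 : Tendsto (fun n : ℕ => (J : ℝ) * (Real.exp 1 / (n : ℝ) ^ ((b - a) / 2))) atTop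
        (𝓝 0) := by
      have := (hYt.const_div_atTop (Real.exp 1)).const_mul (J : ℝ)
      simpa using this
    simpa using h1.add h2
  refine tendsto_of_tendsto_of_tendsto_of_le_of_le' tendsto_const_nhds hlimit
    (Eventually.of_forall fun n => gmFac_nonneg H n (hp n).1 (hp n).2) ?_
  filter_upwards [hnt.eventually_ge_atTop (2 * (Fintype.card V : ℝ) * (Fintype.card V - 1)),
    hnt.eventually_ge_atTop (6 * (Fintype.card V : ℝ)),
    hnt.eventually_ge_atTop ((gmE H).card + 1 : ℝ),
    hYt.eventually_ge_atTop (Real.exp 1),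
    hlim.eventually_ge_atTop (12 * (Fintype.card V : ℝ) ^ 2 / (c ^ a * ε)),
    hlim.eventually_ge_atTop (2 * J / c ^ b), hlim.eventually_gt_atTop 0] with
    n h1 h2 h3 h4 h5 h6 h7
  have hp0 : 0 < p n := by
    rcases eq_or_lt_of_le (hp n).1 with h | h
    · rw [← h, zero_mul] at h7
      exact absurd h7 (lt_irrefl _)
    · exact h
  refine gm_upper_bound H hE x π hπ m' hm' hd hv2 n (p n) a b c ε _ J ha hb ha0 hb0 hc hε hp0
    (hp n).2 (by omega) h1 h2 rfl h4 h5 h6 ?_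
  have hn1 : (1 : ℝ) ≤ n := by
    have : (0 : ℝ) ≤ (gmE H).card := by positivity
    linarith
  calc (((n / Fintype.card V) * (gmE H).card + 1 : ℕ) : ℝ) ≤ ((n * (gmE H).card + 1 : ℕ) : ℝ) := by
        have := Nat.div_le_self n (Fintype.card V)
        gcongr
    _ ≤ (n : ℝ) ^ (2 : ℝ) := by
        rw [Real.rpow_two]
        push_cast
        nlinarith
    _ ≤ (n : ℝ) ^ ((b - a) / 2 * J) := Real.rpow_le_rpow_of_exponent_le hn1 hJ4
    _ = _ := by rw [Real.rpow_mul (by linarith), Real.rpow_natCast]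

end gmG

open MeasureTheory Filter Topology
section gmK
open scoped Classical

lemma gmEx_sum {X ι : Type*} [Fintype X] (q : ℝ) (s : Finset ι) (f : ι → Finset X → ℝ) :
    gmEx q (fun W => ∑ i ∈ s, f i W) = ∑ i ∈ s, gmEx q (f i) := by
  unfold gmEx
  simp_rw [Finset.mul_sum]
  rw [Finset.sum_comm]

lemma gm_lower_bound {V : Type*} [Fintype V] (H : SimpleGraph V) (I : Finset V) (hI : 1 < I.card)
    (n : ℕ) (p : ℝ) (h0 : 0 ≤ p) (h1 : p ≤ 1) :
    ((n / Fintype.card V : ℕ) : ℝ) *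
      gmEx p (fun W : Finset (Sym2 (Fin n)) => if gmFac H n W then (1 : ℝ) else 0) ≤
      (n : ℝ) ^ I.card * p ^ (gmC H I) := by
  set H' : SimpleGraph I := H.comap Subtype.val with hH'
  set A : (I ↪ Fin n) → Finset (Sym2 (Fin n)) := fun g => (gmE H').image (Sym2.map g) with hA
  have hAc : ∀ g, gmC H I ≤ (A g).card := by
    intro g
    rw [hA]
    simp only
    rw [Finset.card_image_of_injective _ (Sym2.map.injective g.injective)]
    unfold gmC
    refine le_trans (Finset.card_le_card (t := (gmE H').image (Sym2.map Subtype.val)) ?_)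
      Finset.card_image_le
    intro e he
    induction e using Sym2.ind with
    | _ u v =>
      simp only [gmE, Finset.mem_filter, Finset.mem_univ, true_and, SimpleGraph.mem_edgeSet,
        Sym2.mem_iff] at he
      rw [Finset.mem_image]
      refine ⟨s(⟨u, he.2 u (Or.inl rfl)⟩, ⟨v, he.2 v (Or.inr rfl)⟩), ?_, rfl⟩
      simp only [gmE, Finset.mem_filter, Finset.mem_univ, true_and, SimpleGraph.mem_edgeSet, hH',
        SimpleGraph.comap_adj]
      exact he.1
  have hpt : ∀ W : Finset (Sym2 (Fin n)),
      (if gmFac H n W then (1 : ℝ) else 0) * ((n / Fintype.card V : ℕ) : ℝ) ≤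
      ∑ g : I ↪ Fin n, if A g ⊆ W then (1 : ℝ) else 0 := by
    intro W
    by_cases hW : gmFac H n W
    · rw [if_pos hW, one_mul, ← Finset.sum_filter, Finset.sum_const, nsmul_eq_mul, mul_one]
      obtain ⟨f, hf, hfW⟩ := hW
      have hcard : (Finset.univ : Finset (Fin (n / Fintype.card V))).card ≤
          (Finset.univ.filter (fun g : I ↪ Fin n => A g ⊆ W)).card := by
        refine Finset.card_le_card_of_injOn (fun k => ⟨fun v => f (k, v.1), ?_⟩) ?_ ?_
        · intro v w hvw
          have := hf hvw
          simp only [Prod.mk.injEq, true_and] at this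
          exact Subtype.ext this
        · intro k _
          simp only [Finset.coe_filter, Finset.mem_univ, true_and, Set.mem_ofPred_eq, hA]
          intro e he
          rw [Finset.mem_image] at he
          obtain ⟨e', h2, rfl⟩ := he
          induction e' using Sym2.ind with
          | _ u v =>
            simp only [gmE, Finset.mem_filter, Finset.mem_univ, true_and,
              SimpleGraph.mem_edgeSet, hH', SimpleGraph.comap_adj] at h2
            exact hfW k _ _ h2
        · intro k _ k' _ heq
          obtain ⟨v, hv⟩ := Finset.card_pos.1 (by omega : 0 < I.card)
          have := DFunLike.congr_fun heq ⟨v, hv⟩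
          have := hf this
          simp only [Prod.mk.injEq, and_true] at this
          exact this
      rw [Finset.card_univ, Fintype.card_fin] at hcard
      exact_mod_cast hcard
    · rw [if_neg hW, zero_mul]
      exact Finset.sum_nonneg fun g _ => by split_ifs <;> norm_num
  have hex := gmEx_mono h0 h1 hpt
  rw [gmEx_mul_const, gmEx_sum] at hex
  rw [mul_comm]
  refine hex.trans ?_
  have hcard : (Fintype.card (I ↪ Fin n) : ℝ) ≤ (n : ℝ) ^ I.card := by
    rw [Fintype.card_embedding_eq, Fintype.card_fin, Fintype.card_coe]
    exact_mod_cast Nat.descFactorial_le_pow _ _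
  calc ∑ g : I ↪ Fin n, gmEx p (fun W => if A g ⊆ W then (1 : ℝ) else 0)
      ≤ ∑ g : I ↪ Fin n, p ^ (gmC H I) := by
        refine Finset.sum_le_sum fun g _ => ?_
        rw [gmEx_superset]
        exact pow_le_pow_of_le_one h0 h1 (hAc g)
    _ ≤ _ := by
        rw [Finset.sum_const, nsmul_eq_mul, Finset.card_univ]
        gcongr

lemma gm_lower {V : Type*} [Fintype V] (H : SimpleGraph V) (hE : H.edgeSet.Nonempty)
    (p : ℕ → ℝ) (hp : ∀ n, 0 ≤ p n ∧ p n ≤ 1)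
    (hlim : Tendsto (fun n : ℕ => p n * (n : ℝ) ^ (1 / m1 H)) atTop (𝓝 0)) :
    Tendsto (fun n : ℕ => gmEx (p n)
      (fun W : Finset (Sym2 (Fin n)) => if gmFac H n W then (1 : ℝ) else 0)) atTop (𝓝 0) := by
  obtain ⟨hm1, I, hI, hC⟩ := gm_m1_attained H hE
  have hIr : (1 : ℝ) < I.card := by exact_mod_cast hI
  have hC0 : gmC H I ≠ 0 := by
    intro h
    rw [h, Nat.cast_zero] at hC
    nlinarith
  have hV : 0 < Fintype.card V := by
    have := Finset.card_le_univ I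
    omega
  have hVr : (0 : ℝ) < Fintype.card V := by exact_mod_cast hV
  have hnt : Tendsto (fun n : ℕ => (n : ℝ)) atTop atTop := tendsto_natCast_atTop_atTop
  have hlimit : Tendsto (fun n : ℕ => 2 * (Fintype.card V : ℝ) *
      (p n * (n : ℝ) ^ (1 / m1 H)) ^ (gmC H I)) atTop (𝓝 0) := by
    have := (hlim.pow (gmC H I)).const_mul (2 * (Fintype.card V : ℝ))
    simpa [zero_pow hC0] using this
  refine tendsto_of_tendsto_of_tendsto_of_le_of_le' tendsto_const_nhds hlimit
    (Eventually.of_forall fun n => ?_) ?_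
  · have h := gmEx_mono (X := Sym2 (Fin n)) (hp n).1 (hp n).2 (f := fun _ => 0)
      (g := fun W => if gmFac H n W then (1 : ℝ) else 0) (fun W => by
        split_ifs <;> norm_num)
    rwa [gmEx_const] at h
  · filter_upwards [hnt.eventually_ge_atTop (2 * (Fintype.card V : ℝ))] with n hn
    have hnpos : (0 : ℝ) < n := by linarith
    have hb := gm_lower_bound H I hI n (p n) (hp n).1 (hp n).2
    have hNlo : (n : ℝ) / (2 * Fintype.card V) ≤ ((n / Fintype.card V : ℕ) : ℝ) := by
      have h1 := Nat.lt_div_mul_add (a := n) (b := Fintype.card V) hV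
      have h2 : (n : ℝ) < ((n / Fintype.card V : ℕ) : ℝ) * Fintype.card V + Fintype.card V := by
        exact_mod_cast h1
      rw [div_le_iff₀ (by positivity)]
      linarith
    have hpow : (n : ℝ) ^ I.card = n * ((n : ℝ) ^ (1 / m1 H)) ^ (gmC H I) := by
      rw [← Real.rpow_natCast ((n : ℝ) ^ (1 / m1 H)), ← Real.rpow_mul hnpos.le, hC]
      have h3 : 1 / m1 H * (m1 H * ((I.card : ℝ) - 1)) = (I.card : ℝ) - 1 := by
        field_simp
      rw [h3, Real.rpow_sub_one hnpos.ne', Real.rpow_natCast]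
      field_simp
    set X := gmEx (p n) (fun W : Finset (Sym2 (Fin n)) => if gmFac H n W then (1 : ℝ) else 0)
    have hX : 0 ≤ X := by
      have h := gmEx_mono (X := Sym2 (Fin n)) (hp n).1 (hp n).2 (f := fun _ => 0)
        (g := fun W => if gmFac H n W then (1 : ℝ) else 0) (fun W => by
          split_ifs <;> norm_num)
      rwa [gmEx_const] at h
    have h4 : (n : ℝ) / (2 * Fintype.card V) * X ≤
        n * ((p n * (n : ℝ) ^ (1 / m1 H)) ^ (gmC H I)) := by
      refine (mul_le_mul_of_nonneg_right hNlo hX).trans (hb.trans (le_of_eq ?_))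
      rw [hpow, mul_pow]; ring
    rw [div_mul_eq_mul_div, div_le_iff₀ (by positivity)] at h4
    refine le_of_mul_le_mul_left ?_ hnpos
    linarith

end gmK

open MeasureTheory Filter Topology
/-- **Gerke–McDowell theorem.** For a graph `H` with at least one edge which is not
vertex-1-balanced, `n^{-1/m₁(H)}` is a threshold for `G(n,p)` to contain an `H`-factor. -/
theorem stmt_7 {V : Type} [Fintype V] (H : SimpleGraph V) (hE : H.edgeSet.Nonempty)
    (hnb : ¬ VertexOneBalanced H) (p : ℕ → ℝ) (hp : ∀ n, 0 ≤ p n ∧ p n ≤ 1) :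
    (Tendsto (fun n : ℕ => p n * (n : ℝ) ^ (1 / m1 H)) atTop (𝓝 0) →
      Tendsto (fun n : ℕ => gnp n (p n) {ω | HasFactor H (graphOf ω)}) atTop (𝓝 0)) ∧
    (Tendsto (fun n : ℕ => p n * (n : ℝ) ^ (1 / m1 H)) atTop atTop →
      Tendsto (fun n : ℕ => gnp n (p n) {ω | HasFactor H (graphOf ω)}) atTop (𝓝 1)) := by
  classical
  have hset : ∀ n (W : Finset (Sym2 (Fin n))), ((fun e => decide (e ∈ W)) ∈
      {ω : Sym2 (Fin n) → Bool | HasFactor H (graphOf ω)}) ↔ gmFac H n W := by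
    intro n W
    rw [Set.mem_ofPred_eq]
    exact gmFac_iff H n W
  have heq : ∀ n, gnp n (p n) {ω | HasFactor H (graphOf ω)} = ENNReal.ofReal (gmEx (p n)
      (fun W : Finset (Sym2 (Fin n)) => if gmFac H n W then (1 : ℝ) else 0)) := by
    intro n
    rw [gm_gnp (hp n).1 (hp n).2]
    congr 2
    funext W
    exact if_congr (hset n W) rfl rfl
  simp_rw [heq]
  constructor
  · intro h
    have := ENNReal.tendsto_ofReal (gm_lower H hE p hp h)
    rw [ENNReal.ofReal_zero] at this
    convert this
  · intro h
    have h1 := (gm_upper H hE hnb p hp h).const_sub 1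
    have h2 : ∀ n, gmEx (p n) (fun W : Finset (Sym2 (Fin n)) => if gmFac H n W then (1 : ℝ) else 0)
        = 1 - gmEx (p n)
          (fun W : Finset (Sym2 (Fin n)) => if gmFac H n W then (0 : ℝ) else 1) := by
      intro n
      rw [eq_sub_iff_add_eq, ← gmEx_add]
      have h3 : (fun W : Finset (Sym2 (Fin n)) => (if gmFac H n W then (1 : ℝ) else 0) +
          (if gmFac H n W then (0 : ℝ) else 1)) = fun _ => 1 := by
        funext W
        split_ifs <;> norm_num
      rw [h3, gmEx_const]
    simp_rw [h2]
    have := ENNReal.tendsto_ofReal h1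
    rw [sub_zero, ENNReal.ofReal_one] at this
    convert this
end

section
/- Given Δ ≥ 2 and 0 < ε < 1/2, let C = 10^6·Δ³·ε^{-1}·log Δ·log²(2/ε). If p ≥ C/n, then a.a.s. G(n,p) simultaneously contains a copy of every tree T with maximum degree Δ(T) ≤ Δ and at most (1−ε)n vertices. -/
open MeasureTheory Filter Topology

/-- Neighbourhood of a set of vertices. -/
noncomputable def nbr {N : Type*} [Fintype N] (G : SimpleGraph N) (U : Finset N) : Finset N := by
  classical exact Finset.univ.filter fun y => ∃ u ∈ U, G.Adj u y

lemma mem_nbr {N : Type*} [Fintype N] (G : SimpleGraph N) (U : Finset N) (y : N) :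
    y ∈ nbr G U ↔ ∃ u ∈ U, G.Adj u y := by
  simp [nbr]

/-- `m`-joinedness. -/
def Joined' {N : Type*} (G : SimpleGraph N) (m : ℕ) : Prop :=
  ∀ A B : Finset N, A.card = m → B.card = m → Disjoint A B → ∃ a ∈ A, ∃ b ∈ B, G.Adj a b

/-- The Friedman-Pippenger type condition with used set `S` and demand `r`. -/
def GoodState {N : Type*} [Fintype N] [DecidableEq N] (G : SimpleGraph N) (m : ℕ) (S : Finset N)
    (r : N → ℕ) : Prop :=
  ∀ U : Finset N, U.card ≤ 2 * m → ∑ x ∈ U, r x ≤ (nbr G U \ S).card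

lemma joined_large {N : Type*} [Fintype N] [DecidableEq N] (G : SimpleGraph N) (m : ℕ)
    (hJ : Joined' G m) (U : Finset N) (hU : m ≤ U.card) :
    Fintype.card N < m + (U ∪ nbr G U).card ∨ m = 0 := by
  by_contra! h
  obtain ⟨h, hm⟩ := h
  obtain ⟨A, hA, hAc⟩ := Finset.exists_subset_card_eq hU
  have h2 : m ≤ ((U ∪ nbr G U)ᶜ).card := by
    rw [Finset.card_compl]; omega
  obtain ⟨B, hB, hBc⟩ := Finset.exists_subset_card_eq h2
  have hBn : ∀ b ∈ B, b ∉ U ∧ b ∉ nbr G U := by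
    intro b hb
    have := hB hb
    simpa using this
  obtain ⟨a, ha, b, hb, hab⟩ := hJ A B hAc hBc (by
    rw [Finset.disjoint_left]
    intro x hx hx'
    exact (hBn x hx').1 (hA hx))
  exact (hBn b hb).2 ((mem_nbr G U b).2 ⟨a, hA ha, hab⟩)

lemma nbr_union {N : Type*} [Fintype N] [DecidableEq N] (G : SimpleGraph N) (U U' : Finset N) :
    nbr G (U ∪ U') = nbr G U ∪ nbr G U' := by
  ext y
  simp only [mem_nbr, Finset.mem_union]
  grind

lemma critical_union {N : Type*} [Fintype N] [DecidableEq N] (G : SimpleGraph N) (m : ℕ)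
    (S : Finset N) (r : N → ℕ) (hg : GoodState G m S r) (U U' : Finset N)
    (hU : U.card ≤ 2 * m)
    (hc : (nbr G U \ S).card ≤ ∑ x ∈ U, r x) (hc' : (nbr G U' \ S).card ≤ ∑ x ∈ U', r x) :
    (nbr G (U ∪ U') \ S).card ≤ ∑ x ∈ U ∪ U', r x := by
  have h1 := Finset.card_union_add_card_inter (nbr G U \ S) (nbr G U' \ S)
  have h2 : nbr G (U ∪ U') \ S = (nbr G U \ S) ∪ (nbr G U' \ S) := by
    rw [nbr_union, Finset.union_sdiff_distrib]
  have h3 : nbr G (U ∩ U') \ S ⊆ (nbr G U \ S) ∩ (nbr G U' \ S) := by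
    intro y
    simp only [Finset.mem_sdiff, Finset.mem_inter, mem_nbr]
    grind
  have h4 := Finset.card_le_card h3
  have h5 := hg (U ∩ U') ((Finset.card_le_card Finset.inter_subset_left).trans hU)
  have h6 := Finset.sum_union_inter (s₁ := U) (s₂ := U') (f := r)
  rw [h2]
  omega

lemma extend_state {N : Type*} [Fintype N] [DecidableEq N] (G : SimpleGraph N) (m D : ℕ)
    (hm : 1 ≤ m) (hJ : Joined' G m) (S : Finset N) (r : N → ℕ) (hr : ∀ x, r x ≤ D)
    (hg : GoodState G m S r) (hn : S.card + 3 * m + 2 * m * D < Fintype.card N)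
    (s : N) (hs : 1 ≤ r s) :
    ∃ y, G.Adj s y ∧ y ∉ S ∧ GoodState G m (insert y S) (Function.update r s (r s - 1)) := by
  by_contra! hcon
  have key : ∀ y ∈ nbr G {s} \ S, ∃ U : Finset N, U.card ≤ 2 * m ∧
      (nbr G U \ S).card ≤ ∑ x ∈ U, r x ∧ s ∉ U ∧ y ∈ nbr G U := by
    intro y hy
    simp only [Finset.mem_sdiff, mem_nbr, Finset.mem_singleton, exists_eq_left] at hy
    have h := hcon y hy.1 hy.2
    unfold GoodState at h
    push Not at h
    obtain ⟨U, hU, hlt⟩ := h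
    have hgU := hg U hU
    have e1 : nbr G U \ insert y S = (nbr G U \ S).erase y := by
      ext z; simp only [Finset.mem_sdiff, Finset.mem_insert, Finset.mem_erase]; tauto
    rw [e1] at hlt
    have e2 : (nbr G U \ S).card ≤ ((nbr G U \ S).erase y).card + 1 := by
      have := Finset.pred_card_le_card_erase (s := nbr G U \ S) (a := y)
      omega
    have e3 : ∑ x ∈ U, Function.update r s (r s - 1) x ≤ ∑ x ∈ U, r x := by
      apply Finset.sum_le_sum
      intro i _
      by_cases hi : i = s
      · subst hi; simp
      · simp [hi]
    refine ⟨U, hU, by omega, ?_, ?_⟩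
    · intro hsU
      have : ∑ x ∈ U, Function.update r s (r s - 1) x < ∑ x ∈ U, r x := by
        apply Finset.sum_lt_sum
        · intro i _
          by_cases hi : i = s
          · subst hi; simp
          · simp [hi]
        · exact ⟨s, hsU, by simp; omega⟩
      omega
    · by_contra hyU
      rw [Finset.erase_eq_of_notMem (by simp [hyU])] at hlt
      omega
  have small : ∀ U : Finset N, U.card ≤ 2 * m → (nbr G U \ S).card ≤ ∑ x ∈ U, r x →
      U.card < m := by
    intro U hU hc
    by_contra! hge
    have h1 := joined_large G m hJ U hge
    have h2 := Finset.card_union_le U (nbr G U)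
    have h3 : (nbr G U).card ≤ (nbr G U \ S).card + S.card := by
      have := Finset.le_card_sdiff S (nbr G U)
      omega
    have h4 : ∑ x ∈ U, r x ≤ U.card * D := by
      have := Finset.sum_le_card_nsmul U r D (fun x _ => hr x)
      simpa using this
    have h5 : U.card * D ≤ 2 * m * D := Nat.mul_le_mul_right _ hU
    omega
  -- union of the critical sets
  have big : ∀ Y : Finset N, Y ⊆ nbr G {s} \ S → ∃ U : Finset N, U.card ≤ 2 * m ∧
      (nbr G U \ S).card ≤ ∑ x ∈ U, r x ∧ s ∉ U ∧ Y ⊆ nbr G U := by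
    intro Y
    induction Y using Finset.induction_on with
    | empty =>
      intro _
      refine ⟨∅, by simp, ?_, by simp, by simp⟩
      have : nbr G (∅ : Finset N) = ∅ := by ext; simp [mem_nbr]
      simp [this]
    | insert y Y hy ih =>
      intro hsub
      obtain ⟨U, hU, hc, hsU, hY⟩ := ih (fun z hz => hsub (Finset.mem_insert_of_mem hz))
      obtain ⟨U', hU', hc', hsU', hY'⟩ := key y (hsub (Finset.mem_insert_self _ _))
      refine ⟨U ∪ U', ?_, critical_union G m S r hg U U' hU hc hc', by simp [hsU, hsU'], ?_⟩
      · have := small U hU hc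
        have := small U' hU' hc'
        have := Finset.card_union_le U U'
        omega
      · rw [nbr_union]
        intro z hz
        rcases Finset.mem_insert.1 hz with rfl | hz
        · exact Finset.mem_union_right _ hY'
        · exact Finset.mem_union_left _ (hY hz)
  obtain ⟨U, hU, hc, hsU, hY⟩ := big _ subset_rfl
  have hlt := small U hU hc
  have h1 := hg (insert s U) (by rw [Finset.card_insert_of_notMem hsU]; omega)
  rw [Finset.sum_insert hsU] at h1
  have h2 : nbr G (insert s U) \ S ⊆ nbr G U \ S := by
    intro z hz
    rw [Finset.insert_eq, nbr_union] at hz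
    simp only [Finset.mem_sdiff, Finset.mem_union] at hz
    rw [Finset.mem_sdiff]
    refine ⟨?_, hz.2⟩
    rcases hz.1 with h | h
    · exact hY (Finset.mem_sdiff.2 ⟨h, hz.2⟩)
    · exact h
  have h3 := Finset.card_le_card h2
  omega

lemma initial_state {N : Type*} [Fintype N] [DecidableEq N] (G : SimpleGraph N) (m D : ℕ)
    (hm : 1 ≤ m) (hJ : Joined' G m) (hn : 5 * m + 4 * m * D ≤ Fintype.card N) :
    ∃ (W : Finset N) (x0 : N) (r : N → ℕ), W.card ≤ 2 * m ∧ x0 ∉ W ∧ (∀ x, r x ≤ D) ∧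
      (∀ x, x ∉ W → r x = D) ∧ GoodState G m (insert x0 W) r := by
  classical
  let P : Finset (Finset N) := Finset.univ.filter fun W => W.card ≤ 2 * m ∧
    (nbr G W \ W).card ≤ D * W.card
  have hP : P.Nonempty := by
    refine ⟨∅, ?_⟩
    have : nbr G (∅ : Finset N) = ∅ := by ext; simp [mem_nbr]
    simp [P, this]
  obtain ⟨W, hW, hmax⟩ := Finset.exists_max_image P Finset.card hP
  simp only [P, Finset.mem_filter, Finset.mem_univ, true_and] at hW hmax
  have hex : ∃ x0, x0 ∉ W := by
    by_contra! h
    have : W = Finset.univ := Finset.eq_univ_iff_forall.2 h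
    have h2 := hW.1
    rw [this, Finset.card_univ] at h2
    omega
  obtain ⟨x0, hx0⟩ := hex
  refine ⟨W, x0, fun x => if x ∈ W then 0 else D, hW.1, hx0, ?_, ?_, ?_⟩
  · intro x; dsimp only; split_ifs <;> simp
  · intro x hx; simp [hx]
  · intro U' hU'
    set U := U' \ W with hUdef
    have hs : ∑ x ∈ U', (if x ∈ W then 0 else D) = U.card * D := by
      rw [Finset.sum_ite]
      simp [hUdef, Finset.filter_notMem_eq_sdiff]
    rw [hs]
    have hUc : U.card ≤ 2 * m := (Finset.card_le_card Finset.sdiff_subset).trans hU'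
    have hsub : nbr G U \ insert x0 W ⊆ nbr G U' \ insert x0 W := by
      apply Finset.sdiff_subset_sdiff _ subset_rfl
      intro y
      simp only [mem_nbr, hUdef, Finset.mem_sdiff]
      grind
    refine le_trans ?_ (Finset.card_le_card hsub)
    rcases Nat.eq_zero_or_pos U.card with h0 | hpos
    · simp [h0]
    by_contra! hlt
    have e1 : nbr G U \ insert x0 W = (nbr G U \ W).erase x0 := by
      ext z; simp only [Finset.mem_sdiff, Finset.mem_insert, Finset.mem_erase]; tauto
    have e2 : (nbr G U \ W).card ≤ ((nbr G U \ W).erase x0).card + 1 := by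
      have := Finset.pred_card_le_card_erase (s := nbr G U \ W) (a := x0)
      omega
    rw [e1] at hlt
    have hdis : Disjoint W U := Finset.disjoint_sdiff
    have hcu : (W ∪ U).card = W.card + U.card := Finset.card_union_of_disjoint hdis
    have hbad : (nbr G (W ∪ U) \ (W ∪ U)).card ≤ D * (W ∪ U).card := by
      have h1 : nbr G (W ∪ U) \ (W ∪ U) ⊆ (nbr G W \ W) ∪ (nbr G U \ W) := by
        rw [nbr_union]
        intro z
        simp only [Finset.mem_sdiff, Finset.mem_union]
        tauto
      have h2 := (Finset.card_le_card h1).trans (Finset.card_union_le _ _)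
      rw [hcu, mul_add]
      have := mul_comm D U.card
      omega
    by_cases hle : (W ∪ U).card ≤ 2 * m
    · have := hmax _ ⟨hle, hbad⟩
      omega
    · have h1 := joined_large G m hJ (W ∪ U) (by omega)
      have h2 : (W ∪ U ∪ nbr G (W ∪ U)).card ≤ (W ∪ U).card + (nbr G (W ∪ U) \ (W ∪ U)).card := by
        rw [← Finset.union_sdiff_self_eq_union]
        exact Finset.card_union_le _ _
      have h3 : D * (W ∪ U).card ≤ 4 * m * D := by
        rw [mul_comm]
        exact Nat.mul_le_mul_right _ (by omega)
      omega

lemma embed_tree {N : Type*} [Fintype N] [DecidableEq N] (G : SimpleGraph N) (m D : ℕ)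
    (hm : 1 ≤ m) (hJ : Joined' G m) (k : ℕ)
    (hn : (k + 1) + 5 * m + 4 * m * D ≤ Fintype.card N) :
    ∀ (j : ℕ), j ≤ k → ∀ (V : Type) [Fintype V] (T : SimpleGraph V), T.IsTree →
      Fintype.card V = j + 1 → (∀ v, (T.neighborSet v).ncard ≤ D) →
      ∃ (f : V → N) (S : Finset N) (r : N → ℕ), Function.Injective f ∧
        (∀ u v, T.Adj u v → G.Adj (f u) (f v)) ∧ S.card ≤ 2 * m + (j + 1) ∧
        (∀ v, f v ∈ S) ∧ (∀ v, D ≤ r (f v) + (T.neighborSet v).ncard) ∧ (∀ x, r x ≤ D) ∧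
        (∀ x, x ∉ S → r x = D) ∧ GoodState G m S r := by
  intro j
  induction j with
  | zero =>
    intro _ V _ T hT hV hdeg
    obtain ⟨W, x0, r, hW, hx0, hr, hrW, hg⟩ := initial_state G m D hm hJ (by omega)
    have hsub : Subsingleton V := Fintype.card_le_one_iff_subsingleton.1 (by omega)
    refine ⟨fun _ => x0, insert x0 W, r, fun a b _ => Subsingleton.elim a b, ?_, ?_, ?_, ?_, hr, ?_, hg⟩
    · intro u v huv
      exact absurd (Subsingleton.elim u v) huv.ne
    · rw [Finset.card_insert_of_notMem hx0]; omega
    · simp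
    · intro v; rw [hrW x0 hx0]; omega
    · intro x hx
      exact hrW x (fun h => hx (Finset.mem_insert_of_mem h))
  | succ j ih =>
    intro hjk V _ T hT hV hdeg
    classical
    have hnt : Nontrivial V := Fintype.one_lt_card_iff_nontrivial.1 (by omega)
    obtain ⟨v, hv⟩ := hT.exists_vert_degree_one_of_nontrivial
    have hconn := hT.1.induce_compl_singleton_of_degree_eq_one hv
    have hT' : (T.induce ({v}ᶜ : Set V)).IsTree := ⟨hconn, hT.2.induce _⟩
    obtain ⟨u, huv, huniq⟩ := (SimpleGraph.degree_eq_one_iff_existsUnique_adj).1 hv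
    have hdle : ∀ w : ({v}ᶜ : Set V), ((T.induce ({v}ᶜ : Set V)).neighborSet w).ncard ≤
        (T.neighborSet w.1 \ {v}).ncard := by
      intro w
      rw [← Set.ncard_image_of_injective _ Subtype.val_injective]
      apply Set.ncard_le_ncard
      · rintro _ ⟨z, hz, rfl⟩
        exact ⟨hz, z.2⟩
      · exact Set.toFinite _
    have hdle2 : ∀ w : ({v}ᶜ : Set V), ((T.induce ({v}ᶜ : Set V)).neighborSet w).ncard ≤
        (T.neighborSet w.1).ncard := fun w =>
      (hdle w).trans (Set.ncard_le_ncard Set.sdiff_subset (Set.toFinite _))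
    obtain ⟨f, S, r, hf, hadj, hS, hfS, hrd, hr, hrS, hg⟩ := ih (by omega) ({v}ᶜ : Set V)
      (T.induce ({v}ᶜ : Set V)) hT' (by
        rw [Fintype.card_compl_set]; simp [hV]) (fun w => (hdle2 w).trans (hdeg _))
    have huv' : u ∈ ({v}ᶜ : Set V) := by simpa using huv.ne'
    have hdu : ((T.induce ({v}ᶜ : Set V)).neighborSet ⟨u, huv'⟩).ncard + 1 ≤
        (T.neighborSet u).ncard := by
      have h1 := hdle ⟨u, huv'⟩
      have h2 := Set.ncard_sdiff_singleton_add_one (s := T.neighborSet u) (a := v) huv.symm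
        (Set.toFinite _)
      simp only at h1
      omega
    have hru : 1 ≤ r (f ⟨u, huv'⟩) := by
      have := hrd ⟨u, huv'⟩
      have := hdeg u
      omega
    obtain ⟨y, hy, hyS, hg'⟩ := extend_state G m D hm hJ S r hr hg (by
      have : 2 * m * D ≤ 4 * m * D := Nat.mul_le_mul_right _ (by omega)
      omega) (f ⟨u, huv'⟩) hru
    have hfu : f ⟨u, huv'⟩ ≠ y := fun h => hyS (h ▸ hfS _)
    refine ⟨fun w => if h : w ∈ ({v}ᶜ : Set V) then f ⟨w, h⟩ else y, insert y S,
      Function.update r (f ⟨u, huv'⟩) (r (f ⟨u, huv'⟩) - 1), ?_, ?_, ?_, ?_, ?_, ?_, ?_, hg'⟩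
    · intro a b hab
      by_cases ha : a ∈ ({v}ᶜ : Set V) <;> by_cases hb : b ∈ ({v}ᶜ : Set V)
      · simp only [ha, hb, dif_pos] at hab
        have := hf hab
        simpa using this
      · simp only [ha, hb, dif_pos, dif_neg, not_false_iff] at hab
        exact absurd (hab ▸ hfS _) hyS
      · simp only [ha, hb, dif_pos, dif_neg, not_false_iff] at hab
        exact absurd (hab ▸ hfS _) hyS
      · simp only [Set.mem_compl_iff, Set.mem_singleton_iff, not_not] at ha hb
        rw [ha, hb]
    · intro a b hab
      by_cases ha : a ∈ ({v}ᶜ : Set V) <;> by_cases hb : b ∈ ({v}ᶜ : Set V)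
      · simp only [ha, hb, dif_pos]
        exact hadj _ _ hab
      · simp only [ha, hb, dif_pos, dif_neg, not_false_iff]
        simp only [Set.mem_compl_iff, Set.mem_singleton_iff, not_not] at hb
        subst hb
        have := huniq a hab.symm
        subst this
        exact hy
      · simp only [ha, hb, dif_pos, dif_neg, not_false_iff]
        simp only [Set.mem_compl_iff, Set.mem_singleton_iff, not_not] at ha
        subst ha
        have := huniq b hab
        subst this
        exact hy.symm
      · simp only [Set.mem_compl_iff, Set.mem_singleton_iff, not_not] at ha hb
        subst ha; subst hb
        exact absurd rfl hab.ne
    · rw [Finset.card_insert_of_notMem hyS]; omega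
    · intro w
      by_cases hw : w ∈ ({v}ᶜ : Set V)
      · simp only [hw, dif_pos]; exact Finset.mem_insert_of_mem (hfS _)
      · simp only [hw, dif_neg, not_false_iff]; exact Finset.mem_insert_self _ _
    · intro w
      by_cases hw : w ∈ ({v}ᶜ : Set V)
      · simp only [hw, dif_pos]
        by_cases hwu : w = u
        · subst hwu
          have := hrd ⟨w, huv'⟩
          simp only [Function.update_self]
          omega
        · have hne : f ⟨w, hw⟩ ≠ f ⟨u, huv'⟩ := fun h => hwu (by simpa using hf h)
          rw [Function.update_of_ne hne]
          have := hrd ⟨w, hw⟩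
          have := hdle2 ⟨w, hw⟩
          simp only at this
          omega
      · simp only [hw, dif_neg, not_false_iff]
        rw [Function.update_of_ne hfu.symm, hrS y hyS]
        omega
    · intro x
      by_cases hx : x = f ⟨u, huv'⟩
      · subst hx
        simp only [Function.update_self]
        have := hr (f ⟨u, huv'⟩)
        omega
      · rw [Function.update_of_ne hx]; exact hr x
    · intro x hx
      simp only [Finset.mem_insert, not_or] at hx
      rw [Function.update_of_ne (fun h => hx.2 (by rw [h]; exact hfS _))]
      exact hrS x hx.2

lemma bernoulli_prob (p : ℝ) : IsProbabilityMeasure (bernoulliMeasure p) := by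
  constructor
  simp [bernoulliMeasure]

lemma bernoulli_false (p : ℝ) (h0 : 0 ≤ p) (h1 : p ≤ 1) :
    bernoulliMeasure p {false} = ENNReal.ofReal (1 - p) := by
  have h : ENNReal.ofReal p ≤ 1 := by simpa using h1
  simp [bernoulliMeasure, min_eq_left h, ENNReal.ofReal_sub _ h0]

lemma prob_no_edge (n : ℕ) (p : ℝ) (h0 : 0 ≤ p) (h1 : p ≤ 1) (m : ℕ) (A B : Finset (Fin n))
    (hA : A.card = m) (hB : B.card = m) (hAB : Disjoint A B) :
    gnp n p {ω | ¬ ∃ a ∈ A, ∃ b ∈ B, (graphOf ω).Adj a b} ≤ ENNReal.ofReal ((1 - p) ^ (m * m)) := by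
  have := bernoulli_prob p
  let E : Finset (Sym2 (Fin n)) := (A ×ˢ B).image fun x => s(x.1, x.2)
  have hE : E.card = m * m := by
    rw [Finset.card_image_of_injOn, Finset.card_product, hA, hB]
    rintro ⟨a, b⟩ hab ⟨c, d⟩ hcd h
    simp only [Finset.coe_product, Set.mem_prod, Finset.mem_coe] at hab hcd
    simp only [Sym2.eq_iff] at h
    rcases h with h | h
    · simp [h]
    · exfalso
      exact Finset.disjoint_left.1 hAB hab.1 (h.1 ▸ hcd.2)
  have hsub : {ω | ¬ ∃ a ∈ A, ∃ b ∈ B, (graphOf ω).Adj a b} ⊆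
      (Set.pi (E : Set (Sym2 (Fin n))) fun _ => ({false} : Set Bool)) := by
    intro ω hω e he
    simp only [E, Finset.coe_image, Set.mem_image, Finset.mem_coe, Finset.mem_product] at he
    obtain ⟨⟨a, b⟩, ⟨ha, hb⟩, rfl⟩ := he
    simp only [Set.mem_setOf_eq, not_exists, not_and] at hω
    have h := hω a ha b hb
    have hne : a ≠ b := fun h => Finset.disjoint_left.1 hAB ha (h ▸ hb)
    simp only [graphOf, SimpleGraph.fromRel_adj, not_and, not_or] at h
    simpa using (h hne).1
  refine (measure_mono hsub).trans ?_
  unfold gnp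
  rw [Measure.pi_pi_finset]
  simp only [bernoulli_false p h0 h1, Finset.prod_const, hE]
  rw [ENNReal.ofReal_pow (by linarith)]

lemma prob_not_joined (n : ℕ) (p : ℝ) (h0 : 0 ≤ p) (h1 : p ≤ 1) (m : ℕ) :
    gnp n p {ω | ¬ Joined' (graphOf ω) m} ≤
      ENNReal.ofReal ((n.choose m : ℝ) ^ 2 * (1 - p) ^ (m * m)) := by
  classical
  let Q := Finset.powersetCard m (Finset.univ : Finset (Fin n))
  let R := (Q ×ˢ Q).filter fun x => Disjoint x.1 x.2
  have hsub : {ω : Sym2 (Fin n) → Bool | ¬ Joined' (graphOf ω) m} ⊆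
      ⋃ x ∈ R, {ω | ¬ ∃ a ∈ x.1, ∃ b ∈ x.2, (graphOf ω).Adj a b} := by
    intro ω hω
    simp only [Set.mem_setOf_eq, Joined'] at hω
    push Not at hω
    obtain ⟨A, B, hA, hB, hAB, h⟩ := hω
    simp only [Set.mem_iUnion, Set.mem_setOf_eq]
    refine ⟨(A, B), by simp [R, Q, Finset.mem_powersetCard, hA, hB, hAB], ?_⟩
    push Not
    exact h
  refine (measure_mono hsub).trans ((measure_biUnion_finset_le _ _).trans ?_)
  have hb : ∀ x ∈ R, gnp n p {ω | ¬ ∃ a ∈ x.1, ∃ b ∈ x.2, (graphOf ω).Adj a b} ≤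
      ENNReal.ofReal ((1 - p) ^ (m * m)) := by
    intro x hx
    simp only [R, Q, Finset.mem_filter, Finset.mem_product, Finset.mem_powersetCard] at hx
    exact prob_no_edge n p h0 h1 m x.1 x.2 hx.1.1.2 hx.1.2.2 hx.2
  refine (Finset.sum_le_card_nsmul _ _ _ hb).trans ?_
  have hR : R.card ≤ n.choose m ^ 2 := by
    refine (Finset.card_filter_le _ _).trans ?_
    simp [Q, sq]
  rw [nsmul_eq_mul, ENNReal.ofReal_mul (by positivity)]
  gcongr
  rw [← Nat.cast_pow, ENNReal.ofReal_natCast]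
  exact_mod_cast hR

lemma bound_real (n m : ℕ) (p L : ℝ) (h1 : p ≤ 1) (hm : 1 ≤ m) (hL : (n : ℝ) ≤ m * Real.exp L)
    (hpm : 2 * (1 + L) + 1 ≤ p * m) :
    (n.choose m : ℝ) ^ 2 * (1 - p) ^ (m * m) ≤ Real.exp (-1) ^ m := by
  have hm' : (0 : ℝ) < m := by exact_mod_cast hm
  have hc : (n.choose m : ℝ) ≤ Real.exp (1 + L) ^ m := by
    have e1 := Nat.choose_le_pow_div (α := ℝ) m n
    have e2 := Real.pow_div_factorial_le_exp (x := (m : ℝ)) hm'.le m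
    calc (n.choose m : ℝ) ≤ (n : ℝ) ^ m / m.factorial := e1
      _ ≤ (m * Real.exp L) ^ m / m.factorial := by gcongr
      _ = ((m : ℝ) ^ m / m.factorial) * Real.exp L ^ m := by rw [mul_pow]; ring
      _ ≤ Real.exp m * Real.exp L ^ m := by gcongr
      _ = Real.exp (1 + L) ^ m := by
        rw [Real.exp_add, mul_pow, ← Real.exp_nat_mul 1 m, mul_one]
  have hp : (1 - p) ^ (m * m) ≤ Real.exp (-(p * m)) ^ m := by
    rw [pow_mul]
    apply pow_le_pow_left₀ (by have : 0 ≤ 1 - p := by linarith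
                               positivity)
    calc (1 - p) ^ m ≤ Real.exp (-p) ^ m :=
          pow_le_pow_left₀ (by linarith) (Real.one_sub_le_exp_neg p) m
      _ = Real.exp (-(p * m)) := by rw [← Real.exp_nat_mul]; ring_nf
  calc (n.choose m : ℝ) ^ 2 * (1 - p) ^ (m * m)
      ≤ (Real.exp (1 + L) ^ m) ^ 2 * Real.exp (-(p * m)) ^ m := by
        have : 0 ≤ 1 - p := by linarith
        gcongr
    _ = (Real.exp (2 * (1 + L) - p * m)) ^ m := by
        rw [← pow_mul, mul_comm m 2, pow_mul, ← mul_pow, ← Real.exp_nat_mul, ← Real.exp_add]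
        congr 2
    _ ≤ Real.exp (-1) ^ m := by
        gcongr
        linarith

lemma const_bound (Δ : ℕ) (hΔ : 2 ≤ Δ) (ε : ℝ) (hε0 : 0 < ε) (hε1 : ε < 1 / 2) :
    2 * (1 + Real.log (14 * Δ / ε)) + 1 ≤
      10 ^ 6 * (Δ : ℝ) ^ 3 * ε⁻¹ * Real.log Δ * Real.log (2 / ε) ^ 2 * (ε / (14 * Δ)) := by
  have hD : (2 : ℝ) ≤ Δ := by exact_mod_cast hΔ
  have hD0 : (0 : ℝ) < Δ := by linarith
  have hl2 := Real.log_two_gt_d9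
  have ha : (1 / 2 : ℝ) ≤ Real.log Δ := by
    have := Real.log_le_log (by norm_num) hD
    linarith
  have hb : (1 : ℝ) ≤ Real.log (2 / ε) := by
    have h4 : (4 : ℝ) ≤ 2 / ε := by
      rw [le_div_iff₀ hε0]; linarith
    have := Real.log_le_log (by norm_num) h4
    have e : Real.log 4 = 2 * Real.log 2 := by
      rw [show (4 : ℝ) = 2 ^ 2 by norm_num, Real.log_pow]; norm_num
    linarith
  have e1 : Real.log (14 * Δ / ε) = Real.log 7 + Real.log Δ + Real.log (2 / ε) := by
    rw [← Real.log_mul (by norm_num) hD0.ne', ← Real.log_mul (by positivity) (by positivity)]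
    congr 1
    field_simp
    norm_num
  have h7 : Real.log 7 ≤ 6 := by
    have := Real.log_le_sub_one_of_pos (x := 7) (by norm_num)
    linarith
  rw [e1]
  set a := Real.log Δ
  set b := Real.log (2 / ε)
  have e2 : 10 ^ 6 * (Δ : ℝ) ^ 3 * ε⁻¹ * a * b ^ 2 * (ε / (14 * Δ)) =
      10 ^ 6 / 14 * (Δ : ℝ) ^ 2 * (a * b ^ 2) := by
    field_simp
  rw [e2]
  have h3 : a * b ≤ a * b ^ 2 := by nlinarith [mul_nonneg (by linarith : 0 ≤ a) (by linarith : (0 : ℝ) ≤ b)]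
  have h4 : a ≤ a * b := by nlinarith
  have h5 : b / 2 ≤ a * b := by nlinarith
  have h6 : (1 : ℝ) ≤ (Δ : ℝ) ^ 2 := by nlinarith
  have h7 : 1000 * (a * b ^ 2) ≤ 10 ^ 6 / 14 * (Δ : ℝ) ^ 2 * (a * b ^ 2) := by
    apply mul_le_mul_of_nonneg_right _ (by linarith)
    nlinarith
  nlinarith

/-- **Alon–Krivelevich–Sudakov theorem.** Given `Δ ≥ 2` and `0 < ε < 1/2`, with
`C = 10⁶·Δ³·ε⁻¹·log Δ·log²(2/ε)`, if `p ≥ C/n` then a.a.s. `G(n,p)` simultaneously contains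
every tree with maximum degree at most `Δ` on at most `(1-ε)n` vertices. -/
theorem stmt_8 (Δ : ℕ) (hΔ : 2 ≤ Δ) (ε : ℝ) (hε0 : 0 < ε) (hε1 : ε < 1 / 2)
    (p : ℕ → ℝ) (hp : ∀ n, 0 ≤ p n ∧ p n ≤ 1)
    (hpge : ∀ᶠ n : ℕ in atTop,
      10 ^ 6 * (Δ : ℝ) ^ 3 * ε⁻¹ * Real.log Δ * Real.log (2 / ε) ^ 2 / n ≤ p n) :
    Tendsto (fun n : ℕ => gnp n (p n)
      {ω | ∀ m : ℕ, (m : ℝ) ≤ (1 - ε) * n → ∀ T : SimpleGraph (Fin m),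
        T.IsTree → maxDeg T ≤ Δ → ContainsCopy T (graphOf ω)}) atTop (𝓝 1) := by
  have hD : (2 : ℝ) ≤ Δ := by exact_mod_cast hΔ
  have hD0 : (0 : ℝ) < Δ := by linarith
  set C : ℝ := 10 ^ 6 * (Δ : ℝ) ^ 3 * ε⁻¹ * Real.log Δ * Real.log (2 / ε) ^ 2 with hC
  have hcb := const_bound Δ hΔ ε hε0 hε1
  rw [← hC] at hcb
  set δ : ℝ := ε / (14 * Δ) with hδ
  have hδ0 : 0 < δ := by positivity
  let M : ℕ → ℕ := fun n => ⌊2 * δ * n⌋₊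
  have hMt : Tendsto M atTop atTop := by
    apply tendsto_nat_floor_atTop.comp
    exact Tendsto.const_mul_atTop (by positivity) tendsto_natCast_atTop_atTop
  have hlow : ∀ᶠ n : ℕ in atTop, 1 - ENNReal.ofReal (Real.exp (-1) ^ M n) ≤ gnp n (p n)
      {ω | ∀ m : ℕ, (m : ℝ) ≤ (1 - ε) * n → ∀ T : SimpleGraph (Fin m),
        T.IsTree → maxDeg T ≤ Δ → ContainsCopy T (graphOf ω)} := by
    filter_upwards [hpge, hMt.eventually_ge_atTop 1, eventually_ge_atTop 1] with n hpn hM1 hn1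
    have hn0 : (0 : ℝ) < n := by exact_mod_cast hn1
    have hMle : (M n : ℝ) ≤ 2 * δ * n := Nat.floor_le (by positivity)
    have hMge : δ * n ≤ M n := by
      have h1 : 2 * δ * n < M n + 1 := Nat.lt_floor_add_one _
      have h2 : (1 : ℝ) ≤ M n := by exact_mod_cast hM1
      nlinarith
    have hprob : gnp n (p n) {ω | ¬ Joined' (graphOf ω) (M n)} ≤
        ENNReal.ofReal (Real.exp (-1) ^ M n) := by
      refine (prob_not_joined n (p n) (hp n).1 (hp n).2 (M n)).trans ?_
      apply ENNReal.ofReal_le_ofReal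
      apply bound_real n (M n) (p n) (Real.log (14 * Δ / ε)) (hp n).2 hM1
      · rw [Real.exp_log (by positivity)]
        have : δ * n * (14 * Δ / ε) = n := by rw [hδ]; field_simp
        calc (n : ℝ) = δ * n * (14 * Δ / ε) := this.symm
          _ ≤ M n * (14 * Δ / ε) := by gcongr
      · refine hcb.trans ?_
        have hC0 : 0 ≤ C / n := by
          have : 0 ≤ Real.log Δ := Real.log_nonneg (by linarith)
          positivity
        calc C * δ = C / n * (δ * n) := by field_simp
          _ ≤ p n * M n := mul_le_mul hpn hMge (by positivity) (hp n).1
    have hsub : {ω : Sym2 (Fin n) → Bool | Joined' (graphOf ω) (M n)} ⊆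
        {ω | ∀ m : ℕ, (m : ℝ) ≤ (1 - ε) * n → ∀ T : SimpleGraph (Fin m),
        T.IsTree → maxDeg T ≤ Δ → ContainsCopy T (graphOf ω)} := by
      intro ω hω m hm T hT hdeg
      have hne : Nonempty (Fin m) := hT.1.nonempty
      obtain ⟨k, rfl⟩ : ∃ k, m = k + 1 := ⟨m - 1, by have := Fin.pos_iff_nonempty.2 hne; omega⟩
      have hcard : (k + 1) + 5 * M n + 4 * M n * Δ ≤ Fintype.card (Fin n) := by
        rw [Fintype.card_fin]
        have h1 : (M n : ℝ) * (7 * Δ) ≤ ε * n := by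
          calc (M n : ℝ) * (7 * Δ) ≤ 2 * δ * n * (7 * Δ) := by gcongr
            _ = ε * n := by rw [hδ]; field_simp; norm_num
        have h2 : (5 : ℝ) * M n ≤ M n * (3 * Δ) := by
          have : (0 : ℝ) ≤ M n := by positivity
          nlinarith
        have h3 : ((k + 1 : ℕ) : ℝ) + 5 * M n + 4 * M n * Δ ≤ n := by nlinarith
        exact_mod_cast h3
      obtain ⟨f, S, r, hf, hadj, -⟩ := embed_tree (graphOf ω) (M n) Δ hM1 hω k hcard k le_rfl
        (Fin (k + 1)) T hT (by simp) (fun v => (Finset.le_sup (f := fun v =>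
          (T.neighborSet v).ncard) (Finset.mem_univ v)).trans hdeg)
      exact ⟨f, hf, fun u v h => hadj u v h⟩
    refine le_trans ?_ (measure_mono hsub)
    have hpm : IsProbabilityMeasure (gnp n (p n)) := by
      have := bernoulli_prob (p n)
      unfold gnp
      infer_instance
    rw [tsub_le_iff_right]
    have hu : (1 : ENNReal) = gnp n (p n) Set.univ := by simp
    rw [hu]
    calc gnp n (p n) Set.univ ≤ gnp n (p n) ({ω | Joined' (graphOf ω) (M n)} ∪
          {ω | ¬ Joined' (graphOf ω) (M n)}) := by
          apply measure_mono
          intro ω _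
          exact em _
      _ ≤ _ := measure_union_le _ _
      _ ≤ _ := by gcongr
  have hlim : Tendsto (fun n => 1 - ENNReal.ofReal (Real.exp (-1) ^ M n)) atTop (𝓝 1) := by
    have h1 : Tendsto (fun n => Real.exp (-1) ^ M n) atTop (𝓝 0) :=
      (tendsto_pow_atTop_nhds_zero_of_lt_one (Real.exp_pos _).le (by simp)).comp hMt
    have h2 := ENNReal.tendsto_ofReal h1
    have h3 := ENNReal.Tendsto.sub (tendsto_const_nhds (x := (1 : ENNReal))) h2 (by simp)
    simpa using h3
  refine tendsto_of_tendsto_of_tendsto_of_le_of_le' hlim tendsto_const_nhds hlow ?_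
  filter_upwards with n
  have hpm : IsProbabilityMeasure (gnp n (p n)) := by
    have := bernoulli_prob (p n)
    unfold gnp
    infer_instance
  exact prob_le_one
end
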